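/- arXiv:math/0503695 — 2 statements merged into one kernel-verified Lean document; each statement's English description precedes it below -/
import Mathlib

section
/- Assume conditions (i) and (iii), and assume Ω has C¹ boundary. Let u, v ∈ C²(closure of Ω) satisfy u ≤ v in Ω and u = v on ∂Ω, and suppose the operator F_2 is degenerate elliptic with respect to u + v, i.e. the symmetric m×m matrix [(Δ_X(u+v))δ_{ij} − (X_s²(u+v))_{ij}] is positive semidefinite at every point of Ω. Then ∫_Ω 𝓕_2[v] ≤ ∫_Ω 𝓕_2[u]. -/
open MeasureTheory Filter Topology

noncomputable section

/-- Action of a first-order vector field with coefficient vector `c` on a function `u`: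
`(Xu)(x) = ∑ j c(x)_j D_j u(x) = Du(x)·c(x)`. -/
def Xop {n : ℕ} (c : (Fin n → ℝ) → (Fin n → ℝ)) (u : (Fin n → ℝ) → ℝ)
    (x : Fin n → ℝ) : ℝ :=
  fderiv ℝ u x (c x)

/-- Lie bracket of the coefficient vector fields `c`, `d`. -/
def vfBracket {n : ℕ} (c d : (Fin n → ℝ) → (Fin n → ℝ)) (x : Fin n → ℝ) :
    Fin n → ℝ :=
  fun l => fderiv ℝ (fun y => d y l) x (c x) - fderiv ℝ (fun y => c y l) x (d x)

/-- The sub-Laplacian `Δ_X u = ∑ i X_i X_i u`. -/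
def subLap {n m : ℕ} (b : Fin m → (Fin n → ℝ) → (Fin n → ℝ))
    (u : (Fin n → ℝ) → ℝ) (x : Fin n → ℝ) : ℝ :=
  ∑ i, Xop (b i) (Xop (b i) u) x

/-- The commutator `[X_i, X_j] u = X_i X_j u - X_j X_i u`. -/
def commOp {n m : ℕ} (b : Fin m → (Fin n → ℝ) → (Fin n → ℝ)) (i j : Fin m)
    (u : (Fin n → ℝ) → ℝ) (x : Fin n → ℝ) : ℝ :=
  Xop (b i) (Xop (b j) u) x - Xop (b j) (Xop (b i) u) x

/-- The symmetric Hessian `X_s² u = [½ (X_i X_j + X_j X_i) u]`. -/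
def symmHess {n m : ℕ} (b : Fin m → (Fin n → ℝ) → (Fin n → ℝ))
    (u : (Fin n → ℝ) → ℝ) (x : Fin n → ℝ) : Matrix (Fin m) (Fin m) ℝ :=
  fun i j => (Xop (b i) (Xop (b j) u) x + Xop (b j) (Xop (b i) u) x) / 2

theorem symmHess_isHermitian {n m : ℕ} (b : Fin m → (Fin n → ℝ) → (Fin n → ℝ))
    (u : (Fin n → ℝ) → ℝ) (x : Fin n → ℝ) : (symmHess b u x).IsHermitian := by
  unfold Matrix.IsHermitian
  ext i j
  simp only [Matrix.conjTranspose_apply, symmHess, star_trivial]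
  ring

/-- Eigenvalues of the symmetric Hessian. -/
def hessEig {n m : ℕ} (b : Fin m → (Fin n → ℝ) → (Fin n → ℝ))
    (u : (Fin n → ℝ) → ℝ) (x : Fin n → ℝ) : Fin m → ℝ :=
  (symmHess_isHermitian b u x).eigenvalues

/-- `k`-th elementary symmetric function of `m` real numbers. -/
def esymmF {m : ℕ} (k : ℕ) (lam : Fin m → ℝ) : ℝ :=
  ∑ s ∈ Finset.powersetCard k (Finset.univ : Finset (Fin m)), ∏ i ∈ s, lam i

/-- `S_{j,i}(λ)`: the `j`-th elementary symmetric function with the variable `λ_i` set to `0`. -/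
def esymmDrop {m : ℕ} (j : ℕ) (i : Fin m) (lam : Fin m → ℝ) : ℝ :=
  ∑ s ∈ Finset.powersetCard j ((Finset.univ : Finset (Fin m)).erase i), ∏ l ∈ s, lam l

/-- `u` is `k`-convex with respect to the vector fields `b` on `Ω`:
`S_j(λ(X_s²u)) ≥ 0` on `Ω` for `j = 1, …, k`. -/
def IsKConvex {n m : ℕ} (Ω : Set (Fin n → ℝ)) (b : Fin m → (Fin n → ℝ) → (Fin n → ℝ))
    (k : ℕ) (u : (Fin n → ℝ) → ℝ) : Prop :=
  ∀ x ∈ Ω, ∀ j, 1 ≤ j → j ≤ k → 0 ≤ esymmF j (hessEig b u x)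

/-- `F_2[u] = S_2(λ(X_s²u))`. -/
def F2fun {n m : ℕ} (b : Fin m → (Fin n → ℝ) → (Fin n → ℝ))
    (u : (Fin n → ℝ) → ℝ) (x : Fin n → ℝ) : ℝ :=
  esymmF 2 (hessEig b u x)

/-- `𝓔_2[u] = ∑_{i<j} ([X_i,X_j]u)²`. -/
def E2fun {n m : ℕ} (b : Fin m → (Fin n → ℝ) → (Fin n → ℝ))
    (u : (Fin n → ℝ) → ℝ) (x : Fin n → ℝ) : ℝ :=
  ∑ i : Fin m, ∑ j ∈ Finset.Ioi i, (commOp b i j u x) ^ 2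

/-- `𝓕_2[u] = F_2[u] + (3/4) 𝓔_2[u]`. -/
def calF2 {n m : ℕ} (b : Fin m → (Fin n → ℝ) → (Fin n → ℝ))
    (u : (Fin n → ℝ) → ℝ) (x : Fin n → ℝ) : ℝ :=
  F2fun b u x + (3 / 4) * E2fun b u x

/-- `|Xu|(x)`, the length of the subelliptic gradient. -/
def XgradNorm {n m : ℕ} (b : Fin m → (Fin n → ℝ) → (Fin n → ℝ))
    (u : (Fin n → ℝ) → ℝ) (x : Fin n → ℝ) : ℝ :=
  Real.sqrt (∑ i, (Xop (b i) u x) ^ 2)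

/-- Condition (i): each `X_i` is divergence free, i.e. anti-self-adjoint. -/
def DivFree {n m : ℕ} (Ω : Set (Fin n → ℝ))
    (b : Fin m → (Fin n → ℝ) → (Fin n → ℝ)) : Prop :=
  ∀ i : Fin m, ∀ x ∈ Ω, ∑ j, fderiv ℝ (fun y => b i y j) x (Pi.single j 1) = 0

/-- The set of iterated Lie brackets generated by the fields `b`. -/
inductive LieGen {n m : ℕ} (b : Fin m → (Fin n → ℝ) → (Fin n → ℝ)) :
    ((Fin n → ℝ) → (Fin n → ℝ)) → Prop
  | base (i : Fin m) : LieGen b (b i)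
  | bracket {c d : (Fin n → ℝ) → (Fin n → ℝ)} :
      LieGen b c → LieGen b d → LieGen b (fun x => vfBracket c d x)

/-- Condition (ii): the Hörmander condition; iterated commutators span `ℝⁿ` at each point. -/
def Hormander {n m : ℕ} (Ω : Set (Fin n → ℝ))
    (b : Fin m → (Fin n → ℝ) → (Fin n → ℝ)) : Prop :=
  ∀ x ∈ Ω, Submodule.span ℝ {v : Fin n → ℝ | ∃ c, LieGen b c ∧ c x = v} = ⊤

/-- Condition (iii): all second commutators `[X_i,[X_i,X_j]]` vanish. -/
def SecondCommVanish {n m : ℕ} (Ω : Set (Fin n → ℝ))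
    (b : Fin m → (Fin n → ℝ) → (Fin n → ℝ)) : Prop :=
  ∀ i j : Fin m, ∀ x ∈ Ω, vfBracket (b i) (fun y => vfBracket (b i) (b j) y) x = 0

/-- `Ω' ⊂⊂ Ω`: `Ω'` is open and compactly contained in `Ω`. -/
def CptIn {n : ℕ} (Ω' Ω : Set (Fin n → ℝ)) : Prop :=
  IsOpen Ω' ∧ IsCompact (closure Ω') ∧ closure Ω' ⊆ Ω

/-- A sub-unitary (piecewise C¹) curve on `[0,T]` with respect to the fields `b`. -/
def IsSubunitary {n m : ℕ} (b : Fin m → (Fin n → ℝ) → (Fin n → ℝ)) (T : ℝ)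
    (γ : ℝ → Fin n → ℝ) : Prop :=
  ContinuousOn γ (Set.Icc 0 T) ∧
  ∃ S : Finset ℝ, ∀ t ∈ Set.Ioo 0 T, t ∉ S →
    ∃ γ' : Fin n → ℝ, HasDerivAt γ γ' t ∧
      ∀ ξ : Fin n → ℝ, (∑ j, γ' j * ξ j) ^ 2 ≤ ∑ i, (∑ j, b i (γ t) j * ξ j) ^ 2

/-- The Carnot–Carathéodory distance associated with the fields `b`. -/
def ccDist {n m : ℕ} (b : Fin m → (Fin n → ℝ) → (Fin n → ℝ))
    (x y : Fin n → ℝ) : ℝ :=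
  sInf {T : ℝ | 0 < T ∧ ∃ γ : ℝ → Fin n → ℝ,
    IsSubunitary b T γ ∧ γ 0 = x ∧ γ T = y}

/-- The C-C ball of radius `R` about `x`. -/
def ccBall {n m : ℕ} (b : Fin m → (Fin n → ℝ) → (Fin n → ℝ))
    (x : Fin n → ℝ) (R : ℝ) : Set (Fin n → ℝ) :=
  {y | ccDist b x y < R}

/-- The doubling property `|B_{tR}(x)| ≥ C t^Q |B_R(x)|`. -/
def DoublingDim {n m : ℕ} (Ω : Set (Fin n → ℝ))
    (b : Fin m → (Fin n → ℝ) → (Fin n → ℝ)) (Q : ℕ) : Prop :=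
  ∃ C > (0 : ℝ), ∃ R0 > (0 : ℝ), ∀ x ∈ Ω, ∀ t ∈ Set.Ioo (0 : ℝ) 1,
    ∀ R : ℝ, 0 < R → R < R0 →
      C * t ^ Q * (volume (ccBall b x R)).toReal ≤ (volume (ccBall b x (t * R))).toReal

/-- `Q` is the homogeneous dimension of the system `b` in `Ω`. -/
def IsHomDim {n m : ℕ} (Ω : Set (Fin n → ℝ))
    (b : Fin m → (Fin n → ℝ) → (Fin n → ℝ)) (Q : ℕ) : Prop :=
  0 < Q ∧ DoublingDim Ω b Q ∧ ∀ Q' : ℕ, 0 < Q' → DoublingDim Ω b Q' → Q ≤ Q'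

/-- The class `φ^k(Ω)` of `L¹_loc(Ω)` limits of smooth `k`-convex functions. -/
def PhiK {n m : ℕ} (Ω : Set (Fin n → ℝ)) (b : Fin m → (Fin n → ℝ) → (Fin n → ℝ))
    (k : ℕ) (u : (Fin n → ℝ) → ℝ) : Prop :=
  LocallyIntegrableOn u Ω ∧
  ∀ Ω' : Set (Fin n → ℝ), CptIn Ω' Ω →
    ∃ us : ℕ → (Fin n → ℝ) → ℝ,
      (∀ l, ContDiffOn ℝ 2 (us l) Ω' ∧ IsKConvex Ω' b k (us l)) ∧
      ∀ K : Set (Fin n → ℝ), K ⊆ Ω' → IsCompact K →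
        Tendsto (fun l => ∫ x in K, |us l x - u x|) atTop (𝓝 0)

end

/-- `Ω` has `C¹` boundary: near each boundary point, `Ω` is the sublevel set of a
`C¹` function with nonvanishing gradient. -/
def HasC1Boundary {n : ℕ} (Ω : Set (Fin n → ℝ)) : Prop :=
  ∀ x ∈ frontier Ω, ∃ U : Set (Fin n → ℝ), IsOpen U ∧ x ∈ U ∧
    ∃ f : (Fin n → ℝ) → ℝ, ContDiff ℝ 1 f ∧ (∀ y ∈ U, fderiv ℝ f y ≠ 0) ∧
      Ω ∩ U = {y ∈ U | f y < 0}

section Monotonicity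

open Set Metric
open scoped ContDiff

/-- `f` is `C^k` with compact support contained in `Ω`. -/
structure IsTestFn {E : Type*} [NormedAddCommGroup E] [NormedSpace ℝ E] (Ω : Set E)
    (k : ℕ∞ω) (f : E → ℝ) : Prop where
  contDiff : ContDiff ℝ k f
  hasCompactSupport : HasCompactSupport f
  tsupport_subset : tsupport f ⊆ Ω

section TestFunctions

variable {E : Type*} [NormedAddCommGroup E] [NormedSpace ℝ E] {Ω : Set E} {k l : ℕ∞ω}
  {f g : E → ℝ}

theorem IsTestFn.of_le (hf : IsTestFn Ω k f) (h : l ≤ k) : IsTestFn Ω l f :=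
  ⟨hf.contDiff.of_le h, hf.hasCompactSupport, hf.tsupport_subset⟩

theorem IsTestFn.eq_zero (hf : IsTestFn Ω k f) {x : E} (hx : x ∉ Ω) : f x = 0 :=
  image_eq_zero_of_notMem_tsupport fun h => hx (hf.tsupport_subset h)

theorem IsTestFn.fderiv_eq_zero (hf : IsTestFn Ω k f) {x : E} (hx : x ∉ Ω) :
    fderiv ℝ f x = 0 :=
  image_eq_zero_of_notMem_tsupport fun h => hx (hf.tsupport_subset (tsupport_fderiv_subset ℝ h))

theorem contDiff_of_contDiffAt_tsupport (h : ∀ x ∈ tsupport f, ContDiffAt ℝ k f x) :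
    ContDiff ℝ k f := by
  refine contDiff_iff_contDiffAt.2 fun x => ?_
  by_cases hx : x ∈ tsupport f
  · exact h x hx
  · exact contDiffAt_const.congr_of_eventuallyEq (notMem_tsupport_iff_eventuallyEq.1 hx)

theorem IsTestFn.mul (hΩ : IsOpen Ω) (hf : IsTestFn Ω k f) (hg : ContDiffOn ℝ k g Ω) :
    IsTestFn Ω k (fun x => f x * g x) := by
  have hsub : tsupport (fun x => f x * g x) ⊆ tsupport f := tsupport_mul_subset_left
  refine ⟨contDiff_of_contDiffAt_tsupport fun x hx => ?_, hf.hasCompactSupport.mul_right,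
    hsub.trans hf.tsupport_subset⟩
  exact hf.contDiff.contDiffAt.mul
    (hg.contDiffAt (hΩ.mem_nhds (hf.tsupport_subset (hsub hx))))

theorem IsTestFn.fderiv_apply (hΩ : IsOpen Ω) (hf : IsTestFn Ω (k + 1) f) {c : E → E}
    (hc : ContDiffOn ℝ k c Ω) : IsTestFn Ω k (fun x => fderiv ℝ f x (c x)) := by
  have hsub : tsupport (fun x => fderiv ℝ f x (c x)) ⊆ tsupport f := by
    refine closure_minimal (fun x hx => ?_) (isClosed_tsupport f)
    by_contra h
    exact hx (by
      simp [image_eq_zero_of_notMem_tsupport fun h' => h (tsupport_fderiv_subset ℝ h')])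
  refine ⟨contDiff_of_contDiffAt_tsupport fun x hx => ?_,
    hf.hasCompactSupport.of_isClosed_subset (isClosed_tsupport _) hsub,
    hsub.trans hf.tsupport_subset⟩
  exact (hf.contDiff.fderiv_right le_rfl).contDiffAt.clm_apply
    (hc.contDiffAt (hΩ.mem_nhds (hf.tsupport_subset (hsub hx))))

theorem IsTestFn.integrable_mul [MeasurableSpace E] [BorelSpace E] {μ : Measure E}
    [IsFiniteMeasureOnCompacts μ] (hΩ : IsOpen Ω) (hf : IsTestFn Ω k f)
    (hg : ContinuousOn g Ω) : Integrable (fun x => f x * g x) μ := by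
  have h := IsTestFn.mul hΩ (hf.of_le zero_le) (contDiffOn_zero.2 hg)
  exact h.contDiff.continuous.integrable_of_hasCompactSupport h.hasCompactSupport

theorem IsTestFn.integrable [MeasurableSpace E] [BorelSpace E] {μ : Measure E}
    [IsFiniteMeasureOnCompacts μ] (hf : IsTestFn Ω k f) : Integrable f μ :=
  hf.contDiff.continuous.integrable_of_hasCompactSupport hf.hasCompactSupport

theorem IsTestFn.integral_fderiv_apply [FiniteDimensional ℝ E] [MeasurableSpace E] [BorelSpace E]
    {μ : Measure E} [μ.IsAddHaarMeasure] (hf : IsTestFn Ω 1 f) (v : E) :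
    ∫ x, fderiv ℝ f x v ∂μ = 0 := by
  have h1 : Integrable (fun x => fderiv ℝ f x v) μ :=
    ((hf.contDiff.continuous_fderiv one_ne_zero).clm_apply
      continuous_const).integrable_of_hasCompactSupport
      (hf.hasCompactSupport.fderiv_apply (𝕜 := ℝ) v)
  have := integral_mul_fderiv_eq_neg_fderiv_mul_of_integrable (μ := μ) (f := fun _ : E => (1 : ℝ))
    (g := f) (v := v) (by simp) (by simpa using h1) (by simpa using hf.integrable)
    (fun _ _ => differentiableAt_const _)
    (fun x _ => hf.contDiff.differentiable one_ne_zero x)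
  simpa using this

/-- If a functional `f ↦ ∫ Df·A + f a` with continuous coefficients vanishes on smooth
test functions, it vanishes on `C¹` test functions. -/
theorem IsTestFn.integral_eq_zero_of_smooth [FiniteDimensional ℝ E] [MeasurableSpace E]
    [BorelSpace E] {μ : Measure E} [μ.IsAddHaarMeasure] (hΩ : IsOpen Ω) {A : E → E} {a : E → ℝ}
    (hA : ContinuousOn A Ω) (ha : ContinuousOn a Ω)
    (hsmooth : ∀ f, IsTestFn Ω ∞ f → ∫ x, (fderiv ℝ f x (A x) + f x * a x) ∂μ = 0)
    (hf : IsTestFn Ω 1 f) : ∫ x, (fderiv ℝ f x (A x) + f x * a x) ∂μ = 0 := by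
  obtain ⟨r, hr, hrΩ⟩ := hf.hasCompactSupport.isCompact.exists_cthickening_subset_open hΩ
    hf.tsupport_subset
  set K := cthickening r (tsupport f) with hK
  have hKc : IsCompact K := hf.hasCompactSupport.isCompact.cthickening
  have hfK : tsupport f ⊆ K := self_subset_cthickening _
  have hDf : Continuous (fderiv ℝ f) := hf.contDiff.continuous_fderiv one_ne_zero
  obtain ⟨M, hM⟩ := hf.hasCompactSupport.exists_bound_of_continuous hf.contDiff.continuous
  obtain ⟨M', hM'⟩ := (hf.hasCompactSupport.fderiv (𝕜 := ℝ)).exists_bound_of_continuous hDf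
  let φ : ℕ → ContDiffBump (0 : E) := fun j =>
    ⟨r / (j + 1) / 2, r / (j + 1), by positivity, half_lt_self (by positivity)⟩
  have hφr : ∀ j, (φ j).rOut ≤ r := fun j => by
    show r / (j + 1) ≤ r
    exact div_le_self hr.le (by simp)
  have hφ0 : Tendsto (fun j => (φ j).rOut) atTop (𝓝 0) := by
    simpa [φ, Function.comp_def] using
      (tendsto_const_div_atTop_nhds_zero_nat r).comp (tendsto_add_atTop_nat 1)
  let F : ℕ → E → ℝ := fun j =>
    convolution ((φ j).normed μ) f (ContinuousLinearMap.lsmul ℝ ℝ) μ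
  have hbump : ∀ j, LocallyIntegrable ((φ j).normed μ) μ := fun j =>
    ((φ j).continuous_normed).locallyIntegrable
  have hFD : ∀ j x e, fderiv ℝ (F j) x e =
      convolution ((φ j).normed μ) (fun y => fderiv ℝ f y e)
        (ContinuousLinearMap.lsmul ℝ ℝ) μ x := by
    intro j x e
    rw [(hf.hasCompactSupport.hasFDerivAt_convolution_right (ContinuousLinearMap.lsmul ℝ ℝ)
      (hbump j) hf.contDiff x).fderiv, convolution_precompR_apply _ (hbump j)
      (hf.hasCompactSupport.fderiv (𝕜 := ℝ)) hDf]
  have hcont : ∀ e, Continuous fun y => fderiv ℝ f y e := fun e => by fun_prop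
  have hFsupp : ∀ j, tsupport (F j) ⊆ K := by
    intro j
    refine closure_minimal (fun x hx => ?_) isClosed_cthickening
    obtain ⟨y, hy, z, hz, rfl⟩ := support_convolution_subset _ hx
    rw [(φ j).support_normed_eq, mem_ball_zero_iff] at hy
    refine mem_cthickening_of_dist_le _ z _ _ (subset_tsupport f hz) ?_
    simpa using (hy.le.trans (hφr j))
  have hFtest : ∀ j, IsTestFn Ω ∞ (F j) := fun j =>
    ⟨(φ j).hasCompactSupport_normed.contDiff_convolution_left _ (φ j).contDiff_normed
      hf.contDiff.continuous.locallyIntegrable,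
      hKc.of_isClosed_subset (isClosed_tsupport _) (hFsupp j), (hFsupp j).trans hrΩ⟩
  have hzero : ∀ {h : E → ℝ}, tsupport h ⊆ K → ∀ x ∉ K, fderiv ℝ h x (A x) + h x * a x = 0 := by
    intro h hh x hx
    have h1 : x ∉ tsupport h := fun h' => hx (hh h')
    simp [image_eq_zero_of_notMem_tsupport h1,
      image_eq_zero_of_notMem_tsupport fun h' => h1 (tsupport_fderiv_subset ℝ h')]
  have hred : ∀ {h : E → ℝ}, tsupport h ⊆ K →
      ∫ x in K, (fderiv ℝ h x (A x) + h x * a x) ∂μ =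
        ∫ x, (fderiv ℝ h x (A x) + h x * a x) ∂μ := fun hh =>
    setIntegral_eq_integral_of_forall_compl_eq_zero (hzero hh)
  have hAK := hA.mono hrΩ
  have haK := ha.mono hrΩ
  have key : Tendsto (fun j => ∫ x in K, (fderiv ℝ (F j) x (A x) + F j x * a x) ∂μ) atTop
      (𝓝 (∫ x in K, (fderiv ℝ f x (A x) + f x * a x) ∂μ)) := by
    refine tendsto_integral_of_dominated_convergence
      (fun x => 3 * M' * ‖A x‖ + 3 * M * ‖a x‖) (fun j => ?_) ?_ (fun j => ?_) ?_
    · refine ContinuousOn.aestronglyMeasurable ?_ hKc.measurableSet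
      exact (((hFtest j).contDiff.continuous_fderiv (by simp)).continuousOn.clm_apply hAK).add
        ((hFtest j).contDiff.continuous.continuousOn.mul haK)
    · refine ContinuousOn.integrableOn_compact hKc ?_
      exact (continuousOn_const.mul hAK.norm).add (continuousOn_const.mul haK.norm)
    · refine Eventually.of_forall fun x => ?_
      have hb : ∀ (g : E → ℝ) (C : ℝ), Continuous g → (∀ y, ‖g y‖ ≤ C) →
          ‖convolution ((φ j).normed μ) g (ContinuousLinearMap.lsmul ℝ ℝ) μ x‖ ≤ 3 * C := by
        intro g C hg hC
        have h1 := (φ j).dist_normed_convolution_le (μ := μ) (x₀ := x) (ε := 2 * C)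
          hg.aestronglyMeasurable (fun y _ => by
            rw [dist_eq_norm]
            linarith [norm_sub_le (g y) (g x), hC x, hC y])
        rw [dist_eq_norm] at h1
        have h2 := norm_le_norm_add_norm_sub'
          (convolution ((φ j).normed μ) g (ContinuousLinearMap.lsmul ℝ ℝ) μ x) (g x)
        linarith [hC x]
      refine (norm_add_le _ _).trans (add_le_add ?_ ?_)
      · rw [hFD]
        refine (hb _ (M' * ‖A x‖) (hcont _) fun y => ?_).trans_eq (by ring)
        exact ((fderiv ℝ f y).le_opNorm _).trans (by gcongr; exact hM' y)
      · rw [norm_mul]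
        gcongr
        exact hb f M hf.contDiff.continuous hM
    · refine Eventually.of_forall fun x => ?_
      refine Tendsto.add ?_ (Tendsto.mul_const _ ?_)
      · simp_rw [hFD]
        exact ContDiffBump.convolution_tendsto_right_of_continuous hφ0 (hcont _) x
      · exact ContDiffBump.convolution_tendsto_right_of_continuous hφ0 hf.contDiff.continuous x
  rw [hred hfK] at key
  refine tendsto_nhds_unique key ?_
  simp_rw [hred (hFsupp _), hsmooth _ (hFtest _)]
  exact tendsto_const_nhds

end TestFunctions

section VectorFields

variable {n : ℕ} {Ω : Set (Fin n → ℝ)} {k : ℕ∞ω} {c d : (Fin n → ℝ) → (Fin n → ℝ)}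
  {f g : (Fin n → ℝ) → ℝ} {x : Fin n → ℝ}

/-- The Euclidean divergence of a vector field. -/
noncomputable def vfDiv (c : (Fin n → ℝ) → (Fin n → ℝ)) (x : Fin n → ℝ) : ℝ :=
  ∑ j, fderiv ℝ (fun y => c y j) x (Pi.single j 1)

theorem IsTestFn.xop (hΩ : IsOpen Ω) (hf : IsTestFn Ω (k + 1) f) (hc : ContDiffOn ℝ k c Ω) :
    IsTestFn Ω k (Xop c f) :=
  IsTestFn.fderiv_apply hΩ hf hc

theorem ContDiffOn.xop (hΩ : IsOpen Ω) (hg : ContDiffOn ℝ (k + 1) g Ω)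
    (hc : ContDiffOn ℝ k c Ω) : ContDiffOn ℝ k (Xop c g) Ω :=
  (hg.fderiv_of_isOpen hΩ le_rfl).clm_apply hc

theorem Xop_mul (hf : DifferentiableAt ℝ f x) (hg : DifferentiableAt ℝ g x) :
    Xop c (fun y => f y * g y) x = f x * Xop c g x + Xop c f x * g x := by
  simp only [Xop]
  rw [fderiv_fun_mul hf hg]
  simp [mul_comm]

theorem Xop_congr (h : f =ᶠ[𝓝 x] g) : Xop c f x = Xop c g x := by
  simp only [Xop, h.fderiv_eq]

theorem vfBracket_eq_lieBracket (hc : DifferentiableAt ℝ c x) (hd : DifferentiableAt ℝ d x) :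
    vfBracket c d x = VectorField.lieBracket ℝ c d x := by
  ext l
  simp only [vfBracket, VectorField.lieBracket, Pi.sub_apply]
  rw [fderiv_apply hc l, fderiv_apply hd l]
  rfl

theorem contDiffOn_vfBracket (hΩ : IsOpen Ω) (hc : ContDiffOn ℝ (k + 1) c Ω)
    (hd : ContDiffOn ℝ (k + 1) d Ω) : ContDiffOn ℝ k (vfBracket c d) Ω := by
  refine contDiffOn_pi.2 fun l => ContDiffOn.sub ?_ ?_
  · exact ((contDiffOn_pi.1 hd l).fderiv_of_isOpen hΩ le_rfl).clm_apply (hc.of_le le_self_add)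
  · exact ((contDiffOn_pi.1 hc l).fderiv_of_isOpen hΩ le_rfl).clm_apply (hd.of_le le_self_add)

theorem Xop_vfBracket (hf : ContDiffAt ℝ 2 f x) (hc : DifferentiableAt ℝ c x)
    (hd : DifferentiableAt ℝ d x) :
    Xop (vfBracket c d) f x = Xop c (Xop d f) x - Xop d (Xop c f) x := by
  unfold Xop
  rw [vfBracket_eq_lieBracket hc hd]
  exact VectorField.fderiv_apply_lieBracket hf (by simp) hd hc

theorem fderiv_apply_eq_sum (L : (Fin n → ℝ) →L[ℝ] ℝ) (v : Fin n → ℝ) :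
    L v = ∑ j, v j * L (Pi.single j 1) := by
  conv_lhs => rw [← Finset.univ_sum_single v, map_sum]
  refine Finset.sum_congr rfl fun j _ => ?_
  rw [← mul_one (v j), ← smul_eq_mul, Pi.single_smul, map_smul, smul_eq_mul, smul_eq_mul, mul_one]

theorem IsTestFn.integral_Xop (hΩ : IsOpen Ω) (hf : IsTestFn Ω 1 f) (hc : ContDiffOn ℝ 1 c Ω)
    (hdiv : ∀ x ∈ Ω, vfDiv c x = 0) : ∫ x, Xop c f x = 0 := by
  have hcj : ∀ j, ContDiffOn ℝ 1 (fun y => c y j) Ω := fun j => contDiffOn_pi.1 hc j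
  have key : ∀ x, Xop c f x = ∑ j, fderiv ℝ (fun y => f y * c y j) x (Pi.single j 1) := by
    intro x
    by_cases hx : x ∈ Ω
    · have h1 : ∀ j, fderiv ℝ (fun y => f y * c y j) x (Pi.single j 1) =
          f x * fderiv ℝ (fun y => c y j) x (Pi.single j 1) +
            c x j * fderiv ℝ f x (Pi.single j 1) := by
        intro j
        rw [fderiv_fun_mul (hf.contDiff.differentiable one_ne_zero x)
          (((hcj j).contDiffAt (hΩ.mem_nhds hx)).differentiableAt one_ne_zero)]
        simp
      simp_rw [h1]
      rw [Finset.sum_add_distrib, ← Finset.mul_sum, ← fderiv_apply_eq_sum]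
      have := hdiv x hx
      rw [vfDiv] at this
      rw [this, mul_zero, zero_add]
      rfl
    · have h1 : ∀ j, fderiv ℝ (fun y => f y * c y j) x = 0 := fun j =>
        (hf.mul hΩ (hcj j)).fderiv_eq_zero hx
      simp [h1, Xop, hf.fderiv_eq_zero hx]
  have hj : ∀ j, IsTestFn Ω 1 fun y => f y * c y j := fun j => hf.mul hΩ (hcj j)
  simp_rw [key]
  rw [integral_finsetSum]
  · exact Finset.sum_eq_zero fun j _ => (hj j).integral_fderiv_apply _
  · intro j _
    exact ((hj j).fderiv_apply (k := 0) hΩ (contDiffOn_const)).integrable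

theorem IsTestFn.integral_mul_Xop (hΩ : IsOpen Ω) (hf : IsTestFn Ω 1 f)
    (hg : ContDiffOn ℝ 1 g Ω) (hc : ContDiffOn ℝ 1 c Ω) (hdiv : ∀ x ∈ Ω, vfDiv c x = 0) :
    ∫ x, f x * Xop c g x = -∫ x, Xop c f x * g x := by
  have h0 := (hf.mul hΩ hg).integral_Xop hΩ hc hdiv
  have hc0 := hc.of_le (zero_le (a := (1 : ℕ∞ω)))
  have h1 : ∀ x, Xop c (fun y => f y * g y) x =
      f x * Xop c g x + Xop c f x * g x := by
    intro x
    by_cases hx : x ∈ Ω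
    · exact Xop_mul (hf.contDiff.differentiable one_ne_zero x)
        ((hg.contDiffAt (hΩ.mem_nhds hx)).differentiableAt one_ne_zero)
    · simp [Xop, (hf.mul hΩ hg).fderiv_eq_zero hx, hf.fderiv_eq_zero hx, hf.eq_zero hx]
  simp_rw [h1] at h0
  rw [integral_add
    (hf.integrable_mul hΩ (ContDiffOn.xop (k := 0) hΩ (by simpa using hg) hc0).continuousOn)
    ((IsTestFn.xop (k := 0) hΩ (by simpa using hf) hc0).integrable_mul hΩ hg.continuousOn)] at h0
  linarith

theorem vfDiv_vfBracket (hΩ : IsOpen Ω) (hc : ContDiffOn ℝ 2 c Ω) (hd : ContDiffOn ℝ 2 d Ω)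
    (hcdiv : ∀ x ∈ Ω, vfDiv c x = 0) (hddiv : ∀ x ∈ Ω, vfDiv d x = 0) (hx : x ∈ Ω) :
    vfDiv (vfBracket c d) x = 0 := by
  -- the divergence of `y ↦ D(d y)(c y)` is symmetric in `c` and `d` for divergence free fields
  have key : ∀ {c d : (Fin n → ℝ) → (Fin n → ℝ)}, ContDiffOn ℝ 2 c Ω → ContDiffOn ℝ 2 d Ω →
      (∀ x ∈ Ω, vfDiv d x = 0) →
      ∑ l, fderiv ℝ (fun y => fderiv ℝ (fun z => d z l) y (c y)) x (Pi.single l 1) =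
        ∑ l, ∑ j, fderiv ℝ (fun z => c z j) x (Pi.single l 1) *
          fderiv ℝ (fun z => d z l) x (Pi.single j 1) := by
    intro c d hc hd hddiv
    have hca := hc.contDiffAt (hΩ.mem_nhds hx)
    have hcd := hca.differentiableAt two_ne_zero
    have hdl : ∀ l, ContDiffAt ℝ 2 (fun z => d z l) x := fun l =>
      (contDiffOn_pi.1 hd l).contDiffAt (hΩ.mem_nhds hx)
    have hDdl : ∀ l, DifferentiableAt ℝ (fderiv ℝ fun z => d z l) x := fun l =>
      ((hdl l).fderiv_right (m := 1) (by norm_num)).differentiableAt one_ne_zero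
    have h1 : ∀ l, fderiv ℝ (fun y => fderiv ℝ (fun z => d z l) y (c y)) x (Pi.single l 1) =
        fderiv ℝ (fderiv ℝ fun z => d z l) x (c x) (Pi.single l 1) +
          ∑ j, fderiv ℝ (fun z => c z j) x (Pi.single l 1) *
            fderiv ℝ (fun z => d z l) x (Pi.single j 1) := by
      intro l
      rw [fderiv_clm_apply (hDdl l) hcd]
      simp only [_root_.add_apply, ContinuousLinearMap.comp_apply,
        ContinuousLinearMap.flip_apply]
      rw [((hdl l).isSymmSndFDerivAt (by simp)).eq, fderiv_apply_eq_sum (fderiv ℝ _ x), add_comm]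
      congr 1
      refine Finset.sum_congr rfl fun j _ => ?_
      rw [fderiv_apply hcd j]
      rfl
    simp_rw [h1]
    rw [Finset.sum_add_distrib, add_eq_right]
    have h2 : fderiv ℝ (vfDiv d) x = 0 := by
      have : vfDiv d =ᶠ[𝓝 x] fun _ => 0 :=
        Filter.eventually_of_mem (hΩ.mem_nhds hx) hddiv
      rw [this.fderiv_eq]
      simp
    have h3 : fderiv ℝ (vfDiv d) x (c x) =
        ∑ l, fderiv ℝ (fderiv ℝ fun z => d z l) x (c x) (Pi.single l 1) := by
      unfold vfDiv
      rw [fderiv_fun_sum fun l _ => (hDdl l).clm_apply (differentiableAt_const _)]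
      simp only [_root_.sum_apply]
      refine Finset.sum_congr rfl fun l _ => ?_
      rw [fderiv_clm_apply (hDdl l) (differentiableAt_const _)]
      simp
    rw [← h3, h2]
    rfl
  have hdiff : ∀ {c d : (Fin n → ℝ) → (Fin n → ℝ)}, ContDiffOn ℝ 2 c Ω → ContDiffOn ℝ 2 d Ω →
      ∀ l, DifferentiableAt ℝ (fun y => fderiv ℝ (fun z => d z l) y (c y)) x := by
    intro c d hc hd l
    have hcd := (hc.contDiffAt (hΩ.mem_nhds hx)).differentiableAt two_ne_zero
    exact (((contDiffOn_pi.1 hd l).contDiffAt (hΩ.mem_nhds hx)).fderiv_right (m := 1)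
      (by norm_num)).differentiableAt one_ne_zero |>.clm_apply hcd
  have hsub : ∀ l, fderiv ℝ (fun y => vfBracket c d y l) x (Pi.single l 1) =
      fderiv ℝ (fun y => fderiv ℝ (fun z => d z l) y (c y)) x (Pi.single l 1) -
        fderiv ℝ (fun y => fderiv ℝ (fun z => c z l) y (d y)) x (Pi.single l 1) := by
    intro l
    simp only [vfBracket]
    rw [fderiv_fun_sub (hdiff hc hd l) (hdiff hd hc l)]
    rfl
  unfold vfDiv
  simp_rw [hsub]
  rw [Finset.sum_sub_distrib, key hc hd hddiv, key hd hc hcdiv, sub_eq_zero, Finset.sum_comm]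
  simp_rw [mul_comm]

/-- Integration by parts of a bilinear null form along two divergence free fields. -/
theorem IsTestFn.integral_Xop_mul_Xop_sub (hΩ : IsOpen Ω) (hf : IsTestFn Ω 1 f)
    (hg : ContDiffOn ℝ 1 g Ω) (hc : ContDiffOn ℝ 2 c Ω) (hd : ContDiffOn ℝ 2 d Ω)
    (hcdiv : ∀ x ∈ Ω, vfDiv c x = 0) (hddiv : ∀ x ∈ Ω, vfDiv d x = 0) :
    ∫ x, (Xop c f x * Xop d g x - Xop d f x * Xop c g x +
      f x * Xop (vfBracket c d) g x) = 0 := by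
  have hc1 : ContDiffOn ℝ 1 c Ω := hc.of_le one_le_two
  have hd1 : ContDiffOn ℝ 1 d Ω := hd.of_le one_le_two
  have hZ : ContDiffOn ℝ 1 (vfBracket c d) Ω :=
    contDiffOn_vfBracket hΩ (by simpa [one_add_one_eq_two] using hc)
      (by simpa [one_add_one_eq_two] using hd)
  have hX : ∀ {e : (Fin n → ℝ) → (Fin n → ℝ)}, ContDiffOn ℝ 1 e Ω →
      ContinuousOn (Xop e g) Ω := fun he =>
    (ContDiffOn.xop (k := 0) hΩ (by simpa using hg) (he.of_le zero_le)).continuousOn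
  have hform : ∀ f : (Fin n → ℝ) → ℝ, ∀ x,
      Xop c f x * Xop d g x - Xop d f x * Xop c g x +
        f x * Xop (vfBracket c d) g x =
      fderiv ℝ f x (Xop d g x • c x - Xop c g x • d x) +
        f x * Xop (vfBracket c d) g x := by
    intro f x
    simp only [map_sub, map_smul, smul_eq_mul, Xop]
    ring
  simp_rw [hform]
  refine IsTestFn.integral_eq_zero_of_smooth hΩ
    (((hX hd1).smul hc.continuousOn).sub ((hX hc1).smul hd.continuousOn)) (hX hZ) ?_ hf
  intro f hf
  simp_rw [← hform]
  have h2 : (2 : ℕ∞ω) ≤ ∞ := ENat.LEInfty.out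
  have hf1 : IsTestFn Ω 1 f := hf.of_le (by simp)
  have hf2 : IsTestFn Ω (1 + 1) f := hf.of_le (by rwa [one_add_one_eq_two])
  have hcf := hf2.xop hΩ hc1
  have hdf := hf2.xop hΩ hd1
  have e1 := hcf.integral_mul_Xop hΩ hg hd1 hddiv
  have e2 := hdf.integral_mul_Xop hΩ hg hc1 hcdiv
  have e3 := hf1.integral_mul_Xop hΩ hg hZ fun x hx => vfDiv_vfBracket hΩ hc hd hcdiv hddiv hx
  have e4 : ∀ x, Xop (vfBracket c d) f x * g x =
      Xop c (Xop d f) x * g x - Xop d (Xop c f) x * g x := by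
    intro x
    by_cases hx : x ∈ Ω
    · rw [Xop_vfBracket (hf.contDiff.contDiffAt.of_le h2)
        ((hc.contDiffAt (hΩ.mem_nhds hx)).differentiableAt two_ne_zero)
        ((hd.contDiffAt (hΩ.mem_nhds hx)).differentiableAt two_ne_zero)]
      ring
    · simp only [Xop, hf.fderiv_eq_zero hx]
      simp [show fderiv ℝ (Xop c f) x = 0 from hcf.fderiv_eq_zero hx,
        show fderiv ℝ (Xop d f) x = 0 from hdf.fderiv_eq_zero hx]
  simp_rw [e4] at e3
  have hint : ∀ {h : (Fin n → ℝ) → ℝ} {e : (Fin n → ℝ) → (Fin n → ℝ)}, IsTestFn Ω 1 h →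
      ContDiffOn ℝ 1 e Ω → Integrable fun x => Xop e h x * g x := fun hh he =>
    (IsTestFn.xop (k := 0) hΩ (by simpa using hh) (he.of_le zero_le)).integrable_mul hΩ
      hg.continuousOn
  rw [integral_sub (hint hdf hc1) (hint hcf hd1)] at e3
  rw [integral_add, integral_sub, e1, e2, e3]
  · ring
  · exact hcf.integrable_mul hΩ (hX hd1)
  · exact hdf.integrable_mul hΩ (hX hc1)
  · exact (hcf.integrable_mul hΩ (hX hd1)).sub (hdf.integrable_mul hΩ (hX hc1))
  · exact hf1.integrable_mul hΩ (hX hZ)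

end VectorFields

section NullForm

variable {n m : ℕ} {Ω : Set (Fin n → ℝ)} {b : Fin m → (Fin n → ℝ) → (Fin n → ℝ)}
  {φ s : (Fin n → ℝ) → ℝ}

theorem IsTestFn.xop_xop (hΩ : IsOpen Ω) (hφ : IsTestFn Ω 2 φ)
    {c d : (Fin n → ℝ) → (Fin n → ℝ)} (hc : ContDiffOn ℝ 1 c Ω) (hd : ContDiffOn ℝ 1 d Ω) :
    IsTestFn Ω 0 (Xop c (Xop d φ)) := by
  refine IsTestFn.xop hΩ ?_ (hc.of_le zero_le)
  rw [zero_add]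
  exact IsTestFn.xop hΩ (by rwa [one_add_one_eq_two]) hd

theorem ContDiffOn.xop_one (hΩ : IsOpen Ω) (hs : ContDiffOn ℝ 2 s Ω)
    {d : (Fin n → ℝ) → (Fin n → ℝ)} (hd : ContDiffOn ℝ 1 d Ω) : ContDiffOn ℝ 1 (Xop d s) Ω :=
  ContDiffOn.xop hΩ (by rwa [one_add_one_eq_two]) hd

theorem ContDiffOn.xop_xop (hΩ : IsOpen Ω) (hs : ContDiffOn ℝ 2 s Ω)
    {c d : (Fin n → ℝ) → (Fin n → ℝ)} (hc : ContDiffOn ℝ 1 c Ω) (hd : ContDiffOn ℝ 1 d Ω) :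
    ContinuousOn (Xop c (Xop d s)) Ω :=
  (ContDiffOn.xop (k := 0) hΩ (by simpa using hs.xop_one hΩ hd) (hc.of_le zero_le)).continuousOn

theorem IsTestFn.integral_xop_xop_null (hΩ : IsOpen Ω) (hb : ∀ i, ContDiffOn ℝ 2 (b i) Ω)
    (hdiv : DivFree Ω b) (hcomm : SecondCommVanish Ω b) (hφ : IsTestFn Ω 2 φ)
    (hs : ContDiffOn ℝ 2 s Ω) (i j : Fin m) :
    ∫ x, (Xop (b i) (Xop (b i) φ) x * Xop (b j) (Xop (b j) s) x +
      Xop (b j) (Xop (b i) φ) x * Xop (b j) (Xop (b i) s) x -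
      2 * (Xop (b j) (Xop (b i) φ) x * Xop (b i) (Xop (b j) s) x)) = 0 := by
  have hb1 : ∀ i, ContDiffOn ℝ 1 (b i) Ω := fun i => (hb i).of_le one_le_two
  have hbd : ∀ i, ∀ x ∈ Ω, DifferentiableAt ℝ (b i) x := fun i x hx =>
    ((hb i).contDiffAt (hΩ.mem_nhds hx)).differentiableAt two_ne_zero
  have hZ : ContDiffOn ℝ 1 (vfBracket (b j) (b i)) Ω :=
    contDiffOn_vfBracket hΩ (by simpa [one_add_one_eq_two] using hb j)
      (by simpa [one_add_one_eq_two] using hb i)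
  have hf : IsTestFn Ω 1 (Xop (b i) φ) :=
    IsTestFn.xop hΩ (by rwa [one_add_one_eq_two]) (hb1 i)
  have hg : ContDiffOn ℝ 1 (Xop (b j) s) Ω := hs.xop_one hΩ (hb1 j)
  have hsa : ∀ x ∈ Ω, ContDiffAt ℝ 2 s x := fun x hx => hs.contDiffAt (hΩ.mem_nhds hx)
  have hZs : ∀ x ∈ Ω, Xop (vfBracket (b j) (b i)) s x =
      Xop (b j) (Xop (b i) s) x - Xop (b i) (Xop (b j) s) x := fun x hx =>
    Xop_vfBracket (hsa x hx) (hbd j x hx) (hbd i x hx)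
  have hcommute : ∀ x ∈ Ω, Xop (vfBracket (b j) (b i)) (Xop (b j) s) x =
      Xop (b j) (Xop (vfBracket (b j) (b i)) s) x := by
    intro x hx
    have h := Xop_vfBracket (hsa x hx) (hbd j x hx)
      ((hZ.contDiffAt (hΩ.mem_nhds hx)).differentiableAt one_ne_zero)
    have h0 : Xop (vfBracket (b j) (vfBracket (b j) (b i))) s x = 0 := by
      unfold Xop
      rw [show vfBracket (b j) (vfBracket (b j) (b i)) x = 0 from hcomm j i x hx, map_zero]
    linarith
  have e1 := hf.integral_Xop_mul_Xop_sub hΩ hg (hb j) (hb i) (hdiv j) (hdiv i)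
  have e2 := hf.integral_mul_Xop hΩ (hs.xop_one hΩ hZ) (hb1 j) (hdiv j)
  have hP : ∀ k, IsTestFn Ω 0 (Xop (b k) (Xop (b i) φ)) := fun k => hφ.xop_xop hΩ (hb1 k) (hb1 i)
  have hZc : ContinuousOn (Xop (vfBracket (b j) (b i)) s) Ω := (hs.xop_one hΩ hZ).continuousOn
  have i1 : Integrable fun x => Xop (b j) (Xop (b i) φ) x * Xop (b i) (Xop (b j) s) x -
      Xop (b i) (Xop (b i) φ) x * Xop (b j) (Xop (b j) s) x :=
    ((hP j).integrable_mul hΩ (hs.xop_xop hΩ (hb1 i) (hb1 j))).sub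
      ((hP i).integrable_mul hΩ (hs.xop_xop hΩ (hb1 j) (hb1 j)))
  have e3 : ∫ x, Xop (b i) φ x * Xop (vfBracket (b j) (b i)) (Xop (b j) s) x =
      ∫ x, Xop (b i) φ x * Xop (b j) (Xop (vfBracket (b j) (b i)) s) x := by
    refine integral_congr_ae (Eventually.of_forall fun x => ?_)
    by_cases hx : x ∈ Ω
    · simp only [hcommute x hx]
    · simp [hf.eq_zero hx]
  rw [integral_add i1 (hf.integrable_mul hΩ (hs.xop_xop hΩ hZ (hb1 j))), e3, e2, ← sub_eq_add_neg,
    ← integral_sub i1 ((hP j).integrable_mul hΩ hZc)] at e1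
  rw [← neg_eq_zero, ← integral_neg, ← e1]
  refine integral_congr_ae (Eventually.of_forall fun x => ?_)
  by_cases hx : x ∈ Ω
  · simp only [hZs x hx]
    ring
  · simp [(hP j).eq_zero hx, (hP i).eq_zero hx]

/-- The (nonsymmetric) coefficient matrix of the linearisation of `𝓕₂` at `s`. -/
noncomputable def linCoeff (b : Fin m → (Fin n → ℝ) → (Fin n → ℝ)) (s : (Fin n → ℝ) → ℝ)
    (x : Fin n → ℝ) (i j : Fin m) : ℝ :=
  (if i = j then subLap b s x else 0) + Xop (b i) (Xop (b j) s) x -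
    2 * Xop (b j) (Xop (b i) s) x

theorem sum_mul_linCoeff (P : Fin m → Fin m → ℝ) (x : Fin n → ℝ) :
    ∑ i, ∑ j, P i j * linCoeff b s x i j =
      ∑ i, ∑ j, (P i i * Xop (b j) (Xop (b j) s) x + P j i * Xop (b j) (Xop (b i) s) x -
        2 * (P j i * Xop (b i) (Xop (b j) s) x)) := by
  have h : ∀ i j, P i j * linCoeff b s x i j = (if i = j then P i i * subLap b s x else 0) +
      (P i j * Xop (b i) (Xop (b j) s) x - 2 * (P i j * Xop (b j) (Xop (b i) s) x)) := by
    intro i j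
    unfold linCoeff
    split_ifs with hij
    · subst hij; ring
    · ring
  simp_rw [h, add_sub_assoc, Finset.sum_add_distrib]
  congr 1
  · simp [subLap, Finset.mul_sum]
  · exact Finset.sum_comm

theorem IsTestFn.integral_sum_mul_linCoeff (hΩ : IsOpen Ω) (hb : ∀ i, ContDiffOn ℝ 2 (b i) Ω)
    (hdiv : DivFree Ω b) (hcomm : SecondCommVanish Ω b) (hφ : IsTestFn Ω 2 φ)
    (hs : ContDiffOn ℝ 2 s Ω) :
    ∫ x in Ω, ∑ i, ∑ j, Xop (b i) (Xop (b j) φ) x * linCoeff b s x i j = 0 := by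
  have hb1 : ∀ i, ContDiffOn ℝ 1 (b i) Ω := fun i => (hb i).of_le one_le_two
  have hP : ∀ k i, IsTestFn Ω 0 (Xop (b k) (Xop (b i) φ)) := fun k i =>
    hφ.xop_xop hΩ (hb1 k) (hb1 i)
  have hS : ∀ k i, ContinuousOn (Xop (b k) (Xop (b i) s)) Ω := fun k i =>
    hs.xop_xop hΩ (hb1 k) (hb1 i)
  rw [setIntegral_eq_integral_of_forall_compl_eq_zero fun x hx => by
    simp [fun k i => (hP k i).eq_zero hx]]
  simp_rw [fun x => sum_mul_linCoeff (b := b) (s := s) (fun i j => Xop (b i) (Xop (b j) φ) x) x]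
  have hint : ∀ i j, Integrable fun x =>
      Xop (b i) (Xop (b i) φ) x * Xop (b j) (Xop (b j) s) x +
      Xop (b j) (Xop (b i) φ) x * Xop (b j) (Xop (b i) s) x -
      2 * (Xop (b j) (Xop (b i) φ) x * Xop (b i) (Xop (b j) s) x) := fun i j =>
    (((hP i i).integrable_mul hΩ (hS j j)).add ((hP j i).integrable_mul hΩ (hS j i))).sub
      (((hP j i).integrable_mul hΩ (hS i j)).const_mul 2)
  rw [integral_finsetSum _ fun i _ => integrable_finsetSum _ fun j _ => hint i j]
  refine Finset.sum_eq_zero fun i _ => ?_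
  rw [integral_finsetSum _ fun j _ => hint i j]
  exact Finset.sum_eq_zero fun j _ => hφ.integral_xop_xop_null hΩ hb hdiv hcomm hs i j

end NullForm

/-- At almost every zero of a `C¹` function its derivative vanishes. -/
theorem ContDiffOn.ae_fderiv_eq_zero {E : Type*} [NormedAddCommGroup E] [NormedSpace ℝ E]
    [FiniteDimensional ℝ E] [MeasurableSpace E] [BorelSpace E] {μ : Measure E}
    [μ.IsAddHaarMeasure] {Ω : Set E} {f : E → ℝ} (hΩ : IsOpen Ω) (hf : ContDiffOn ℝ 1 f Ω) :
    ∀ᵐ x ∂μ, x ∈ Ω → f x = 0 → fderiv ℝ f x = 0 := by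
  have hmeas : MeasurableSet (Ω ∩ f ⁻¹' {0}ᶜ) :=
    (hf.continuousOn.isOpen_inter_preimage hΩ isOpen_compl_singleton).measurableSet
  have key : ∀ v : E, ∀ᵐ x ∂μ, x ∈ {x | x ∈ Ω → f x = 0 → fderiv ℝ f x v = 0} := by
    intro v
    have hs : {x | x ∈ Ω → f x = 0 → fderiv ℝ f x v = 0} =
        Ωᶜ ∪ (Ω ∩ f ⁻¹' {0}ᶜ) ∪ (fun x => fderiv ℝ f x v) ⁻¹' {0} := by
      ext x
      by_cases hx : x ∈ Ω <;> by_cases h0 : f x = 0 <;> simp [hx, h0]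
    refine ae_mem_of_ae_add_linearMap_mem (LinearMap.toSpanSingleton ℝ E v) volume μ ?_ fun y => ?_
    · rw [hs]
      exact (hΩ.measurableSet.compl.union hmeas).union
        (measurable_fderiv_apply_const ℝ f v (measurableSet_singleton 0))
    · rw [ae_iff]
      refine measure_null_of_locally_null _ fun t ht => ⟨{t}, ?_, by simp⟩
      simp only [LinearMap.toSpanSingleton_apply, mem_ofPred_eq, Classical.not_imp] at ht
      obtain ⟨htΩ, -, htv⟩ := ht
      have hline : HasDerivAt (fun r : ℝ => y + r • v) v t := by
        simpa using ((hasDerivAt_id t).smul_const v).const_add y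
      have hd : HasDerivAt (fun r : ℝ => f (y + r • v)) (fderiv ℝ f (y + t • v) v) t :=
        ((hf.contDiffAt (hΩ.mem_nhds htΩ)).differentiableAt
          one_ne_zero).hasFDerivAt.comp_hasDerivAt t hline
      have hev := eventually_nhdsWithin_iff.1 (hd.eventually_ne (c := 0) htv)
      filter_upwards [mem_nhdsWithin_of_mem_nhds hev, self_mem_nhdsWithin] with r hr hrs
      simp only [LinearMap.toSpanSingleton_apply, Classical.not_imp] at hrs
      by_contra hne
      exact hr hne hrs.2.1
  have hall := ae_all_iff.2 fun k => key (Module.finBasis ℝ E k)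
  filter_upwards [hall] with x hx hxΩ h0
  exact ContinuousLinearMap.coe_injective
    ((Module.finBasis ℝ E).ext fun k => by simpa using hx k hxΩ h0)

theorem Finset.two_mul_sum_powersetCard_two {ι : Type*} [DecidableEq ι] (s : Finset ι)
    (f : ι → ℝ) :
    2 * ∑ t ∈ s.powersetCard 2, ∏ i ∈ t, f i = (∑ i ∈ s, f i) ^ 2 - ∑ i ∈ s, f i ^ 2 := by
  induction s using Finset.induction_on with
  | empty => rw [Finset.powersetCard_eq_empty.2 (by simp)]; simp
  | insert a s ha ih =>
    have h : ∑ t ∈ s.powersetCard 1, ∏ i ∈ insert a t, f i = f a * ∑ i ∈ s, f i := by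
      rw [Finset.powersetCard_one, Finset.sum_map, Finset.mul_sum]
      refine Finset.sum_congr rfl fun i hi => ?_
      have hai : a ≠ i := fun h => ha (h ▸ hi)
      simp [Finset.prod_pair hai]
    rw [Finset.powersetCard_succ_insert ha, Finset.sum_union, Finset.sum_image, h, mul_add, ih,
      Finset.sum_insert ha, Finset.sum_insert ha]
    · ring
    · intro t ht r hr htr
      have hat : ∀ {t : Finset ι}, t ∈ s.powersetCard 1 → a ∉ t := fun ht h =>
        ha ((Finset.mem_powersetCard.1 ht).1 h)
      rw [← Finset.erase_insert (hat ht), htr, Finset.erase_insert (hat hr)]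
    · refine Finset.disjoint_left.2 fun t ht ht' => ?_
      obtain ⟨r, -, rfl⟩ := Finset.mem_image.1 ht'
      exact ha ((Finset.mem_powersetCard.1 ht).1 (Finset.mem_insert_self a r))

theorem Finset.two_mul_sum_sum_Ioi {m : ℕ} {f : Fin m → Fin m → ℝ} (hf : ∀ i j, f i j = f j i)
    (h0 : ∀ i, f i i = 0) :
    2 * ∑ i, ∑ j ∈ Finset.Ioi i, f i j = ∑ i, ∑ j, f i j := by
  have h : ∑ i, ∑ j ∈ Finset.Ioi i, f i j = ∑ i, ∑ j, if i < j then f i j else 0 :=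
    Finset.sum_congr rfl fun i _ => by
      rw [← Finset.sum_filter]
      exact Finset.sum_congr (by ext; simp) fun _ _ => rfl
  rw [two_mul]
  nth_rewrite 2 [h]
  rw [Finset.sum_comm, h, ← Finset.sum_add_distrib]
  refine Finset.sum_congr rfl fun i _ => ?_
  rw [← Finset.sum_add_distrib]
  refine Finset.sum_congr rfl fun j _ => ?_
  rcases lt_trichotomy i j with hij | rfl | hij
  · simp [hij, hij.le]
  · simp [h0]
  · simp [hij, hij.le, hf i j]

theorem Matrix.IsHermitian.sum_sq_eigenvalues {ι : Type*} [Fintype ι] [DecidableEq ι]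
    {A : Matrix ι ι ℝ} (hA : A.IsHermitian) :
    ∑ i, hA.eigenvalues i ^ 2 = (A * A).trace := by
  have h := hA.spectral_theorem
  conv_rhs => rw [h]
  rw [← map_mul, Unitary.conjStarAlgAut_apply, Matrix.trace_mul_comm, ← mul_assoc]
  simp [Matrix.trace_diagonal, Matrix.diagonal_mul_diagonal, pow_two]

section Algebra

variable {n m : ℕ} {Ω : Set (Fin n → ℝ)} {b : Fin m → (Fin n → ℝ) → (Fin n → ℝ)}
  {u v : (Fin n → ℝ) → ℝ} {x : Fin n → ℝ}

theorem two_mul_calF2 (b : Fin m → (Fin n → ℝ) → (Fin n → ℝ)) (u : (Fin n → ℝ) → ℝ)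
    (x : Fin n → ℝ) :
    2 * calF2 b u x = subLap b u x ^ 2 + (∑ i, ∑ j, Xop (b i) (Xop (b j) u) x ^ 2) -
      2 * ∑ i, ∑ j, Xop (b i) (Xop (b j) u) x * Xop (b j) (Xop (b i) u) x := by
  have hE : 2 * E2fun b u x = ∑ i, ∑ j, commOp b i j u x ^ 2 :=
    Finset.two_mul_sum_sum_Ioi (fun i j => by unfold commOp; ring) fun i => by simp [commOp]
  have hF : 2 * F2fun b u x = (symmHess b u x).trace ^ 2 -
      (symmHess b u x * symmHess b u x).trace := by
    have h := Finset.two_mul_sum_powersetCard_two Finset.univ (hessEig b u x)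
    unfold F2fun esymmF
    rw [h, (symmHess_isHermitian b u x).trace_eq_sum_eigenvalues,
      ← (symmHess_isHermitian b u x).sum_sq_eigenvalues]
    simp [hessEig]
  have htr : (symmHess b u x).trace = subLap b u x := by
    simp [Matrix.trace, symmHess, subLap]
  have hsq : (symmHess b u x * symmHess b u x).trace =
      ∑ i, ∑ j, symmHess b u x i j * symmHess b u x j i := by
    simp [Matrix.trace, Matrix.mul_apply]
  have hswap : ∑ i, ∑ j, Xop (b j) (Xop (b i) u) x ^ 2 =
      ∑ i, ∑ j, Xop (b i) (Xop (b j) u) x ^ 2 := Finset.sum_comm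
  unfold calF2
  rw [mul_add, mul_left_comm, hE, hF, htr, hsq]
  have e1 : ∑ i, ∑ j, symmHess b u x i j * symmHess b u x j i =
      (1 / 4) * (∑ i, ∑ j, Xop (b i) (Xop (b j) u) x ^ 2) +
      (1 / 4) * (∑ i, ∑ j, Xop (b j) (Xop (b i) u) x ^ 2) +
      (1 / 2) * ∑ i, ∑ j, Xop (b i) (Xop (b j) u) x * Xop (b j) (Xop (b i) u) x := by
    simp only [Finset.mul_sum, ← Finset.sum_add_distrib]
    refine Finset.sum_congr rfl fun i _ => Finset.sum_congr rfl fun j _ => ?_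
    unfold symmHess
    ring
  have e2 : ∑ i, ∑ j, commOp b i j u x ^ 2 =
      (∑ i, ∑ j, Xop (b i) (Xop (b j) u) x ^ 2) +
      (∑ i, ∑ j, Xop (b j) (Xop (b i) u) x ^ 2) -
      2 * ∑ i, ∑ j, Xop (b i) (Xop (b j) u) x * Xop (b j) (Xop (b i) u) x := by
    simp only [Finset.mul_sum, ← Finset.sum_add_distrib, ← Finset.sum_sub_distrib]
    refine Finset.sum_congr rfl fun i _ => Finset.sum_congr rfl fun j _ => ?_
    unfold commOp
    ring
  rw [e1, e2, hswap]
  ring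

theorem Xop_Xop_add (hΩ : IsOpen Ω) (hu : ContDiffOn ℝ 2 u Ω) (hv : ContDiffOn ℝ 2 v Ω)
    {c d : (Fin n → ℝ) → (Fin n → ℝ)} (hd : ContDiffOn ℝ 1 d Ω) (hx : x ∈ Ω) :
    Xop c (Xop d fun y => u y + v y) x = Xop c (Xop d u) x + Xop c (Xop d v) x := by
  have hadd : ∀ {f g : (Fin n → ℝ) → ℝ} {e : (Fin n → ℝ) → (Fin n → ℝ)}, ContDiffOn ℝ 1 f Ω →
      ContDiffOn ℝ 1 g Ω → ∀ y ∈ Ω, Xop e (fun y => f y + g y) y = Xop e f y + Xop e g y := by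
    intro f g e hf hg y hy
    unfold Xop
    rw [fderiv_fun_add ((hf.contDiffAt (hΩ.mem_nhds hy)).differentiableAt one_ne_zero)
      ((hg.contDiffAt (hΩ.mem_nhds hy)).differentiableAt one_ne_zero), _root_.add_apply]
  rw [← hadd (hu.xop_one hΩ hd) (hv.xop_one hΩ hd) x hx]
  refine Xop_congr ?_
  filter_upwards [hΩ.mem_nhds hx] with y hy
  exact hadd (hu.of_le one_le_two) (hv.of_le one_le_two) y hy

theorem Xop_Xop_sub (hΩ : IsOpen Ω) (hu : ContDiffOn ℝ 2 u Ω) (hv : ContDiffOn ℝ 2 v Ω)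
    {c d : (Fin n → ℝ) → (Fin n → ℝ)} (hd : ContDiffOn ℝ 1 d Ω) (hx : x ∈ Ω) :
    Xop c (Xop d fun y => v y - u y) x = Xop c (Xop d v) x - Xop c (Xop d u) x := by
  have h := Xop_Xop_add (c := c) hΩ (hv.sub hu) hu hd hx
  simp only [sub_add_cancel] at h
  exact eq_sub_of_add_eq h.symm

theorem calF2_sub_calF2 (hΩ : IsOpen Ω) (hb : ∀ i, ContDiffOn ℝ 1 (b i) Ω)
    (hu : ContDiffOn ℝ 2 u Ω) (hv : ContDiffOn ℝ 2 v Ω) (hx : x ∈ Ω) :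
    2 * (calF2 b v x - calF2 b u x) = ∑ i, ∑ j, Xop (b i) (Xop (b j) fun y => v y - u y) x *
      linCoeff b (fun y => u y + v y) x i j := by
  rw [mul_sub, two_mul_calF2, two_mul_calF2, sum_mul_linCoeff]
  simp_rw [fun i j => Xop_Xop_sub (c := b i) hΩ hu hv (hb j) hx,
    fun i j => Xop_Xop_add (c := b i) hΩ hu hv (hb j) hx]
  set p : Fin m → Fin m → ℝ := fun i j => Xop (b i) (Xop (b j) u) x
  set q : Fin m → Fin m → ℝ := fun i j => Xop (b i) (Xop (b j) v) x
  have hp : ∀ i j, Xop (b i) (Xop (b j) u) x = p i j := fun _ _ => rfl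
  have hq : ∀ i j, Xop (b i) (Xop (b j) v) x = q i j := fun _ _ => rfl
  have hswap : ∀ f : Fin m → Fin m → ℝ, ∑ i, ∑ j, f j i = ∑ i, ∑ j, f i j := fun f =>
    Finset.sum_comm
  have e : ∑ i, ∑ j, ((q i i - p i i) * (p j j + q j j) + (q j i - p j i) * (p j i + q j i) -
      2 * ((q j i - p j i) * (p i j + q i j))) =
      (∑ i, (q i i - p i i)) * (∑ j, (p j j + q j j)) + (∑ i, ∑ j, q j i ^ 2) -
      (∑ i, ∑ j, p j i ^ 2) - 2 * ((∑ i, ∑ j, q i j * q j i) - (∑ i, ∑ j, p i j * p j i) +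
      (∑ i, ∑ j, q j i * p i j) - ∑ i, ∑ j, q i j * p j i) := by
    rw [Finset.sum_mul_sum]
    simp only [Finset.mul_sum, ← Finset.sum_add_distrib, ← Finset.sum_sub_distrib]
    refine Finset.sum_congr rfl fun i _ => Finset.sum_congr rfl fun j _ => ?_
    ring
  unfold subLap
  simp only [hp, hq]
  rw [e, hswap fun i j => q i j ^ 2, hswap fun i j => p i j ^ 2, hswap fun i j => q i j * p j i,
    Finset.sum_sub_distrib, Finset.sum_add_distrib]
  ring

theorem sum_mul_mul_linCoeff_nonneg {s : (Fin n → ℝ) → ℝ} (ξ : Fin m → ℝ)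
    (h : (Matrix.diagonal (fun _ : Fin m => subLap b s x) - symmHess b s x).PosSemidef) :
    0 ≤ ∑ i, ∑ j, ξ i * ξ j * linCoeff b s x i j := by
  have h := h.dotProduct_mulVec_nonneg ξ
  simp only [dotProduct, Matrix.mulVec, star_trivial, Finset.mul_sum, Matrix.sub_apply,
    Matrix.diagonal_apply] at h
  set p : Fin m → Fin m → ℝ := fun i j => Xop (b i) (Xop (b j) s) x
  have hswap : ∑ i, ∑ j, ξ i * ξ j * p j i = ∑ i, ∑ j, ξ i * ξ j * p i j := by
    rw [Finset.sum_comm]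
    exact Finset.sum_congr rfl fun i _ => Finset.sum_congr rfl fun j _ => by ring
  have e1 : ∑ i, ∑ j, ξ i * ξ j * linCoeff b s x i j =
      (∑ i, ∑ j, ξ i * ξ j * (if i = j then subLap b s x else 0)) +
      (∑ i, ∑ j, ξ i * ξ j * p i j) - 2 * ∑ i, ∑ j, ξ i * ξ j * p j i := by
    simp only [Finset.mul_sum, ← Finset.sum_add_distrib, ← Finset.sum_sub_distrib]
    refine Finset.sum_congr rfl fun i _ => Finset.sum_congr rfl fun j _ => ?_
    unfold linCoeff
    ring
  have e2 : ∑ i, ∑ j, ξ i * (((if i = j then subLap b s x else 0) - symmHess b s x i j) * ξ j) =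
      (∑ i, ∑ j, ξ i * ξ j * (if i = j then subLap b s x else 0)) -
      ((1 / 2) * (∑ i, ∑ j, ξ i * ξ j * p i j) + (1 / 2) * ∑ i, ∑ j, ξ i * ξ j * p j i) := by
    simp only [Finset.mul_sum, ← Finset.sum_add_distrib, ← Finset.sum_sub_distrib]
    refine Finset.sum_congr rfl fun i _ => Finset.sum_congr rfl fun j _ => ?_
    unfold symmHess
    ring
  rw [e2] at h
  rw [e1]
  linarith

end Algebra

section Integrability

variable {n m : ℕ} {Ω : Set (Fin n → ℝ)} {b : Fin m → (Fin n → ℝ) → (Fin n → ℝ)}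
  {f u : (Fin n → ℝ) → ℝ}

/-- On `Ω`, near each point of `closure Ω`, `f` agrees with a function which is `C^k` up to the
boundary. -/
def ContDiffUpToBdry (Ω : Set (Fin n → ℝ)) (k : ℕ) (f : (Fin n → ℝ) → ℝ) : Prop :=
  ∀ x ∈ closure Ω, ∃ g, f =ᶠ[𝓝[Ω] x] g ∧ ContDiffWithinAt ℝ k g (closure Ω) x

theorem ContDiffUpToBdry.xop (hΩ : IsOpen Ω) {k : ℕ} (hf : ContDiffUpToBdry Ω (k + 1) f)
    {c : (Fin n → ℝ) → (Fin n → ℝ)} (hc : ContDiffOn ℝ k c (closure Ω)) :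
    ContDiffUpToBdry Ω k (Xop c f) := by
  intro x hx
  obtain ⟨g, hfg, hg⟩ := hf x hx
  rw [Nat.cast_add, Nat.cast_one, contDiffWithinAt_succ_iff_hasFDerivWithinAt' (by simp)] at hg
  obtain ⟨U, hU, -, -, g', hg', hg'c⟩ := hg
  rw [insert_eq_of_mem hx] at hU
  refine ⟨fun y => g' y (c y), ?_, hg'c.clm_apply (hc x hx)⟩
  filter_upwards [eventually_eventually_nhdsWithin.2 hfg, self_mem_nhdsWithin,
    nhdsWithin_mono x subset_closure hU] with y hy hyΩ hyU
  rw [hΩ.nhdsWithin_eq hyΩ] at hy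
  have h := (hg' y hyU).hasFDerivAt (mem_of_superset (hΩ.mem_nhds hyΩ) subset_closure)
  rw [Xop, EventuallyEq.fderiv_eq hy, h.fderiv]

theorem ContDiffUpToBdry.exists_continuousOn (hΩ : IsOpen Ω) (hf : ContDiffUpToBdry Ω 0 f) :
    ∃ g, ContinuousOn g (closure Ω) ∧ EqOn f g Ω := by
  have hlim : ∀ x ∈ closure Ω, ∃ y, Tendsto f (𝓝[Ω] x) (𝓝 y) := by
    intro x hx
    obtain ⟨g, hfg, hg⟩ := hf x hx
    exact ⟨g x, (hg.continuousWithinAt.mono subset_closure).congr' hfg.symm⟩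
  refine ⟨extendFrom Ω f, continuousOn_extendFrom subset_rfl hlim, fun x hx => ?_⟩
  obtain ⟨g, hfg, hg⟩ := hf x (subset_closure hx)
  rw [extendFrom_eq (subset_closure hx)
    ((hg.continuousWithinAt.mono subset_closure).congr' hfg.symm)]
  rw [hΩ.nhdsWithin_eq hx] at hfg
  exact hfg.eq_of_nhds

theorem integrableOn_calF2 (hΩ : IsOpen Ω) (hΩb : Bornology.IsBounded Ω)
    (hb : ∀ i, ContDiffOn ℝ 1 (b i) (closure Ω)) (hu : ContDiffOn ℝ 2 u (closure Ω)) :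
    IntegrableOn (calF2 b u) Ω := by
  have hu' : ContDiffUpToBdry Ω (1 + 1) u := fun x hx => ⟨u, EventuallyEq.rfl, hu x hx⟩
  have h : ∀ i j, ∃ g, ContinuousOn g (closure Ω) ∧ EqOn (Xop (b i) (Xop (b j) u)) g Ω :=
    fun i j => ((hu'.xop hΩ (hb j)).xop hΩ ((hb i).of_le zero_le)).exists_continuousOn hΩ
  choose g hg hug using h
  have hcont : ContinuousOn (fun x => ((∑ i, g i i x) ^ 2 + (∑ i, ∑ j, g i j x ^ 2) -
      2 * ∑ i, ∑ j, g i j x * g j i x) / 2) (closure Ω) := by fun_prop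
  refine ((hcont.integrableOn_compact hΩb.isCompact_closure).mono_set
    subset_closure).congr_fun (fun x hx => ?_) hΩ.measurableSet
  have h2 := two_mul_calF2 b u x
  simp only [subLap, hug _ _ hx] at h2
  simp only [← h2]
  ring

end Integrability

section Cutoff

theorem exists_cutoff {ε : ℝ} (hε : 0 < ε) : ∃ H h : ℝ → ℝ, (∀ t, HasDerivAt H (h t) t) ∧
    ContDiff ℝ 1 h ∧ Monotone h ∧ (∀ t, h t ∈ Icc 0 1) ∧ (∀ t ≤ ε, H t = 0) ∧
    ∀ t, 2 * ε ≤ t → h t = 1 := by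
  set h : ℝ → ℝ := fun t => Real.smoothTransition (t / ε - 1)
  have hh : ContDiff ℝ 1 h := Real.smoothTransition.contDiff.comp
    ((contDiff_id.div_const ε).sub contDiff_const)
  refine ⟨fun t => ∫ r in (0 : ℝ)..t, h r, h,
    fun t => (hh.continuous.integral_hasStrictDerivAt 0 t).hasDerivAt, hh, fun s t hst =>
      Real.smoothTransition.monotone (by gcongr),
    fun t => ⟨Real.smoothTransition.nonneg _, Real.smoothTransition.le_one _⟩, fun t ht => ?_,
    fun t ht => Real.smoothTransition.one_of_one_le ?_⟩
  · refine intervalIntegral.integral_zero_ae (Eventually.of_forall fun r hr => ?_)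
    refine Real.smoothTransition.zero_of_nonpos ?_
    have hr' : r ≤ ε := hr.2.trans (max_le hε.le ht)
    linarith [(div_le_one hε).2 hr']
  · linarith [(le_div_iff₀ hε).2 ht]

variable {n m : ℕ} {Ω : Set (Fin n → ℝ)} {b : Fin m → (Fin n → ℝ) → (Fin n → ℝ)}
  {w s : (Fin n → ℝ) → ℝ} {x : Fin n → ℝ}

theorem isTestFn_indicator_comp (hΩ : IsOpen Ω) (hΩb : Bornology.IsBounded Ω)
    (hw : ContDiffOn ℝ 2 w Ω) (hwc : ContinuousOn w (closure Ω)) (hw0 : ∀ x ∈ frontier Ω, w x = 0)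
    {ε : ℝ} (hε : 0 < ε) {H : ℝ → ℝ} (hH : ContDiff ℝ 2 H) (hH0 : ∀ t ≤ ε, H t = 0) :
    IsTestFn Ω 2 (Ω.indicator fun x => H (w x)) := by
  set K := closure Ω ∩ w ⁻¹' Ici ε
  have hK : IsClosed K := hwc.preimage_isClosed_of_isClosed isClosed_closure isClosed_Ici
  have hKΩ : K ⊆ Ω := by
    rintro x ⟨hx, hwx⟩
    by_contra hxΩ
    have h0 := hw0 x (by rw [hΩ.frontier_eq]; exact ⟨hx, hxΩ⟩)
    rw [mem_preimage, mem_Ici, h0] at hwx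
    exact hwx.not_gt hε
  have hsub : tsupport (Ω.indicator fun x => H (w x)) ⊆ K := by
    refine closure_minimal (fun x hx => ?_) hK
    have hxΩ : x ∈ Ω := by
      by_contra h
      exact hx (indicator_of_notMem h _)
    refine ⟨subset_closure hxΩ, ?_⟩
    by_contra h
    refine hx ?_
    rw [indicator_of_mem hxΩ, hH0 _ (not_le.1 h).le]
  refine ⟨contDiff_of_contDiffAt_tsupport fun x hx => ?_,
    (hΩb.isCompact_closure.of_isClosed_subset hK inter_subset_left).of_isClosed_subset
      (isClosed_tsupport _) hsub, hsub.trans hKΩ⟩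
  have hxΩ := hΩ.mem_nhds (hKΩ (hsub hx))
  refine (hH.contDiffAt.comp x (hw.contDiffAt hxΩ)).congr_of_eventuallyEq ?_
  filter_upwards [hxΩ] with y hy
  exact indicator_of_mem hy _

theorem Xop_comp {c : (Fin n → ℝ) → (Fin n → ℝ)} {h : ℝ → ℝ} {h' : ℝ}
    (hh : HasDerivAt h h' (w x)) (hw : DifferentiableAt ℝ w x) :
    Xop c (fun y => h (w y)) x = h' * Xop c w x := by
  have hc : HasFDerivAt (fun y => h (w y)) (h' • fderiv ℝ w x) x :=
    hh.comp_hasFDerivAt x hw.hasFDerivAt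
  simp [Xop, hc.fderiv]

theorem Xop_Xop_indicator_comp (hΩ : IsOpen Ω) (hw : ContDiffOn ℝ 2 w Ω) {H h : ℝ → ℝ}
    (hH : ∀ t, HasDerivAt H (h t) t) (hh : ContDiff ℝ 1 h) {c d : (Fin n → ℝ) → (Fin n → ℝ)}
    (hd : ContDiffOn ℝ 1 d Ω) (hx : x ∈ Ω) :
    Xop c (Xop d (Ω.indicator fun y => H (w y))) x =
      h (w x) * Xop c (Xop d w) x + deriv h (w x) * (Xop c w x * Xop d w x) := by
  have hwd : ∀ y ∈ Ω, DifferentiableAt ℝ w y := fun y hy =>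
    (hw.contDiffAt (hΩ.mem_nhds hy)).differentiableAt two_ne_zero
  have hev : Xop d (Ω.indicator fun y => H (w y)) =ᶠ[𝓝 x] fun y => h (w y) * Xop d w y := by
    filter_upwards [hΩ.mem_nhds hx] with y hy
    rw [← Xop_comp (hH _) (hwd y hy)]
    refine Xop_congr ?_
    filter_upwards [hΩ.mem_nhds hy] with z hz
    exact indicator_of_mem hz _
  have hhd : HasDerivAt h (deriv h (w x)) (w x) :=
    ((hh.differentiable one_ne_zero) _).hasDerivAt
  rw [Xop_congr hev, Xop_mul (f := fun y => h (w y)) (hhd.differentiableAt.comp x (hwd x hx))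
    (((hw.xop_one hΩ hd).contDiffAt (hΩ.mem_nhds hx)).differentiableAt one_ne_zero),
    Xop_comp hhd (hwd x hx)]
  ring

end Cutoff

section Comparison

variable {n m : ℕ} {Ω : Set (Fin n → ℝ)} {b : Fin m → (Fin n → ℝ) → (Fin n → ℝ)}
  {w s : (Fin n → ℝ) → ℝ}

theorem continuousOn_linCoeff (hΩ : IsOpen Ω) (hb : ∀ i, ContDiffOn ℝ 1 (b i) Ω)
    (hs : ContDiffOn ℝ 2 s Ω) (i j : Fin m) : ContinuousOn (fun x => linCoeff b s x i j) Ω := by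
  have h : ∀ i j, ContinuousOn (Xop (b i) (Xop (b j) s)) Ω := fun i j =>
    hs.xop_xop hΩ (hb i) (hb j)
  have hl : ContinuousOn (subLap b s) Ω := continuousOn_finsetSum _ fun i _ => h i i
  unfold linCoeff
  split_ifs
  · exact (hl.add (h i j)).sub ((h j i).const_mul 2)
  · exact (continuousOn_const.add (h i j)).sub ((h j i).const_mul 2)

theorem ae_xop_xop_eq_zero (hΩ : IsOpen Ω) (hb : ∀ i, ContDiffOn ℝ 1 (b i) Ω)
    (hw : ContDiffOn ℝ 2 w Ω) :
    ∀ᵐ x, x ∈ Ω → w x = 0 → ∀ i j, Xop (b i) (Xop (b j) w) x = 0 := by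
  filter_upwards [(hw.of_le one_le_two).ae_fderiv_eq_zero hΩ,
    ae_all_iff.2 fun j => (hw.xop_one hΩ (hb j)).ae_fderiv_eq_zero hΩ] with x h1 h2 hx h0 i j
  have h : Xop (b j) w x = 0 := by simp [Xop, h1 hx h0]
  simp [Xop.eq_1 (b i), h2 j hx h]

theorem integral_sum_mul_linCoeff_nonpos (hΩ : IsOpen Ω) (hΩb : Bornology.IsBounded Ω)
    (hb : ∀ i, ContDiffOn ℝ 2 (b i) Ω) (hdiv : DivFree Ω b) (hcomm : SecondCommVanish Ω b)
    (hw : ContDiffOn ℝ 2 w Ω) (hwc : ContinuousOn w (closure Ω)) (hw0 : ∀ x ∈ frontier Ω, w x = 0)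
    (hwn : ∀ x ∈ Ω, 0 ≤ w x) (hs : ContDiffOn ℝ 2 s Ω)
    (hell : ∀ x ∈ Ω,
      (Matrix.diagonal (fun _ : Fin m => subLap b s x) - symmHess b s x).PosSemidef)
    (hint : IntegrableOn (fun x => ∑ i, ∑ j, Xop (b i) (Xop (b j) w) x * linCoeff b s x i j) Ω) :
    ∫ x in Ω, ∑ i, ∑ j, Xop (b i) (Xop (b j) w) x * linCoeff b s x i j ≤ 0 := by
  have hb1 : ∀ i, ContDiffOn ℝ 1 (b i) Ω := fun i => (hb i).of_le one_le_two
  set K : (Fin n → ℝ) → ℝ := fun x =>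
    ∑ i, ∑ j, Xop (b i) (Xop (b j) w) x * linCoeff b s x i j with hKdef
  have hε : ∀ k : ℕ, (0 : ℝ) < 1 / (k + 1) := fun k => Nat.one_div_pos_of_nat
  choose H h hH hh hmono h01 hH0 h1 using fun k : ℕ => exists_cutoff (hε k)
  have hmeas : ∀ k, AEStronglyMeasurable (fun x => h k (w x)) (volume.restrict Ω) := fun k =>
    ((hh k).continuous.comp_continuousOn hw.continuousOn).aestronglyMeasurable hΩ.measurableSet
  have hnorm : ∀ k x, ‖h k (w x)‖ ≤ 1 := fun k x => by
    rw [Real.norm_of_nonneg (h01 k _).1]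
    exact (h01 k _).2
  have hle : ∀ k, ∫ x in Ω, h k (w x) * K x ≤ 0 := by
    intro k
    have hHc : ContDiff ℝ 2 (H k) := by
      rw [← one_add_one_eq_two, contDiff_succ_iff_deriv]
      refine ⟨fun t => (hH k t).differentiableAt, by simp, ?_⟩
      rw [show deriv (H k) = h k from funext fun t => (hH k t).deriv]
      exact hh k
    have hφ := isTestFn_indicator_comp hΩ hΩb hw hwc hw0 (hε k) hHc (hH0 k)
    rw [← hφ.integral_sum_mul_linCoeff hΩ hb hdiv hcomm hs]
    refine setIntegral_mono_on (hint.bdd_mul (hmeas k) (Eventually.of_forall (hnorm k)))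
      (integrable_finsetSum _ fun i _ => integrable_finsetSum _ fun j _ =>
        ((hφ.xop_xop hΩ (hb1 i) (hb1 j)).integrable_mul hΩ
          (continuousOn_linCoeff hΩ hb1 hs i j))) hΩ.measurableSet fun x hx => ?_
    simp only [Xop_Xop_indicator_comp hΩ hw (hH k) (hh k) (hb1 _) hx]
    have hQ := mul_nonneg ((hmono k).deriv_nonneg (x := w x))
      (sum_mul_mul_linCoeff_nonneg (fun i => Xop (b i) w x) (hell x hx))
    simp only [hKdef, add_mul, Finset.sum_add_distrib, Finset.mul_sum, mul_assoc] at hQ ⊢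
    linarith
  have htend : Tendsto (fun k => ∫ x in Ω, h k (w x) * K x) atTop (𝓝 (∫ x in Ω, K x)) := by
    refine tendsto_integral_of_dominated_convergence (fun x => ‖K x‖)
      (fun k => (hmeas k).mul hint.aestronglyMeasurable) hint.norm (fun k => ?_) ?_
    · refine Eventually.of_forall fun x => ?_
      rw [norm_mul]
      exact mul_le_of_le_one_left (norm_nonneg _) (hnorm k x)
    · rw [ae_restrict_iff' hΩ.measurableSet]
      filter_upwards [ae_xop_xop_eq_zero hΩ hb1 hw] with x hx hxΩ
      rcases (hwn x hxΩ).eq_or_lt' with h0 | hpos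
      · have hK0 : K x = 0 := by simp [hKdef, hx hxΩ h0]
        simp only [hK0, mul_zero, tendsto_const_nhds]
      · refine tendsto_const_nhds.congr' ?_
        have hlim : Tendsto (fun k : ℕ => 2 * (1 / ((k : ℝ) + 1))) atTop (𝓝 0) := by
          simpa using tendsto_one_div_add_atTop_nhds_zero_nat.const_mul (2 : ℝ)
        filter_upwards [hlim.eventually_le_const hpos] with k hk
        rw [h1 k _ hk, one_mul]
  exact le_of_tendsto' htend hle

end Comparison

end Monotonicity

/-- Lemma 2.1, monotonicity. If `u ≤ v` in `Ω`, `u = v` on `∂Ω` and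
`F₂` is degenerate elliptic with respect to `u + v`, then `∫_Ω 𝓕₂[v] ≤ ∫_Ω 𝓕₂[u]`. -/
theorem monotonicity_calF2 (n m : ℕ) (Ω : Set (Fin n → ℝ))
    (hΩo : IsOpen Ω) (hΩb : Bornology.IsBounded Ω) (hΩc : HasC1Boundary Ω)
    (b : Fin m → (Fin n → ℝ) → (Fin n → ℝ))
    (hb : ∀ i, ContDiffOn ℝ (⊤ : ℕ∞) (b i) (closure Ω))
    (hcond1 : DivFree Ω b) (hcond3 : SecondCommVanish Ω b)
    (u v : (Fin n → ℝ) → ℝ)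
    (hu : ContDiffOn ℝ 2 u (closure Ω)) (hv : ContDiffOn ℝ 2 v (closure Ω))
    (huv : ∀ x ∈ Ω, u x ≤ v x) (hbd : ∀ x ∈ frontier Ω, u x = v x)
    (hell : ∀ x ∈ Ω,
      (Matrix.diagonal (fun _ : Fin m => subLap b (fun y => u y + v y) x) -
        symmHess b (fun y => u y + v y) x).PosSemidef) :
    ∫ x in Ω, calF2 b v x ≤ ∫ x in Ω, calF2 b u x := by
  have hb2 : ∀ i, ContDiffOn ℝ 2 (b i) (closure Ω) := fun i => (hb i).of_le ENat.LEInfty.out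
  have hbΩ : ∀ i, ContDiffOn ℝ 2 (b i) Ω := fun i => (hb2 i).mono subset_closure
  have huΩ := hu.mono subset_closure
  have hvΩ := hv.mono subset_closure
  have hdiff : ∀ x ∈ Ω, 2 * (calF2 b v x - calF2 b u x) =
      ∑ i, ∑ j, Xop (b i) (Xop (b j) fun y => v y - u y) x *
        linCoeff b (fun y => u y + v y) x i j := fun x hx =>
    calF2_sub_calF2 hΩo (fun i => (hbΩ i).of_le one_le_two) huΩ hvΩ hx
  have hiu : IntegrableOn (calF2 b u) Ω :=
    integrableOn_calF2 hΩo hΩb (fun i => (hb2 i).of_le one_le_two) hu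
  have hiv : IntegrableOn (calF2 b v) Ω :=
    integrableOn_calF2 hΩo hΩb (fun i => (hb2 i).of_le one_le_two) hv
  have hle := integral_sum_mul_linCoeff_nonpos hΩo hΩb hbΩ hcond1 hcond3 (hvΩ.sub huΩ)
    (hv.continuousOn.sub hu.continuousOn) (fun x hx => by simp [hbd x hx])
    (fun x hx => sub_nonneg.2 (huv x hx)) (huΩ.add hvΩ) hell
    (IntegrableOn.congr_fun ((hiv.sub hiu).const_mul 2) hdiff hΩo.measurableSet)
  rw [← setIntegral_congr_fun hΩo.measurableSet hdiff, integral_const_mul,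
    integral_sub hiv hiu] at hle
  linarith
end

section
/- Let u ∈ C²(Ω) be k-convex with respect to X, with 2 ≤ k < m, let 0 ≤ r < m(k−1)/(m−k) and set p = r + 2. Then at every point of Ω where Xu ≠ 0, |Xu|^r Δ_X u ≤ [ m(k−1) / ( m(k−1) − r(m−k) ) ] · Δ_p u, where Δ_p u = |Xu|^{p−2}( Δ_X u + (p−2)|Xu|^{−2} Σ_{i,j} X_iu · X_ju · X_iX_ju ). -/
open MeasureTheory Filter Topology

open Polynomial in
/-- The derivative of a polynomial with only real roots has only real roots. -/
theorem splits_derivative_of_splits {q : ℝ[X]} (hq : q.Splits) :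
    (derivative q).Splits := by
  rw [splits_iff_card_roots] at *
  have h₁ := card_roots_le_derivative q
  have h₂ := natDegree_derivative_le q
  have h₃ := card_roots' (derivative q)
  rcases Nat.eq_zero_or_pos q.natDegree with h | h
  · simp [derivative_of_natDegree_zero h]
  · omega

open Polynomial in
/-- Iterated derivatives preserve real-rootedness. -/
theorem splits_iterate_derivative_of_splits {q : ℝ[X]} (hq : q.Splits) (t : ℕ) :
    (derivative^[t] q).Splits := by
  induction t with
  | zero => exact hq
  | succ t ih =>
    rw [Function.iterate_succ_apply']
    exact splits_derivative_of_splits ih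

open Polynomial in
/-- Laguerre's inequality for a monic product of real linear factors. -/
theorem laguerre_multiset_prod (s : Multiset ℝ) (x : ℝ) :
    (s.card : ℝ) * ((s.map fun y => X - C y).prod.eval x *
        (derivative (derivative (s.map fun y => X - C y).prod)).eval x) ≤
      ((s.card : ℝ) - 1) * (derivative (s.map fun y => X - C y).prod).eval x ^ 2 := by
  induction s using Multiset.induction_on with
  | empty => simp
  | cons y s ih =>
    rcases s.empty_or_exists_mem with rfl | ⟨z, hz⟩
    · simp
    have hpos : (0 : ℝ) < s.card := by exact_mod_cast Multiset.card_pos_iff_exists_mem.2 ⟨z, hz⟩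
    simp only [Multiset.map_cons, Multiset.prod_cons, Multiset.card_cons, derivative_mul,
      derivative_add, derivative_sub, derivative_X, derivative_C, eval_add, eval_mul, eval_sub,
      eval_X, eval_C, Nat.cast_add, Nat.cast_one, sub_zero, one_mul]
    set R := eval x (s.map fun y => X - C y).prod
    set R' := eval x (derivative (s.map fun y => X - C y).prod)
    set R'' := eval x (derivative (derivative (s.map fun y => X - C y).prod))
    set e : ℝ := (s.card : ℝ)
    refine le_of_mul_le_mul_left ?_ hpos
    nlinarith [sq_nonneg (e * R - (x - y) * R'),
      mul_le_mul_of_nonneg_left ih (mul_nonneg (sq_nonneg (x - y)) (by linarith : 0 ≤ e + 1))]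

open Polynomial in
/-- Laguerre's inequality for a real-rooted polynomial. -/
theorem laguerre_of_splits {q : ℝ[X]} (hq : q.Splits) (x : ℝ) :
    (q.natDegree : ℝ) * (q.eval x * (derivative (derivative q)).eval x) ≤
      ((q.natDegree : ℝ) - 1) * (derivative q).eval x ^ 2 := by
  have h := laguerre_multiset_prod q.roots x
  rw [← hq.natDegree_eq_card_roots] at h
  have hq' := hq.eq_prod_roots
  set P := (q.roots.map fun y => X - C y).prod
  rw [show q.eval x = q.leadingCoeff * P.eval x by conv_lhs => rw [hq']; simp,
    show (derivative q).eval x = q.leadingCoeff * (derivative P).eval x by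
      conv_lhs => rw [hq']; simp,
    show (derivative (derivative q)).eval x =
      q.leadingCoeff * (derivative (derivative P)).eval x by conv_lhs => rw [hq']; simp]
  nlinarith [mul_le_mul_of_nonneg_left h (sq_nonneg q.leadingCoeff)]

open Polynomial in
/-- **Newton's inequalities** for the elementary symmetric functions of real numbers. -/
theorem newton_esymm (s : Multiset ℝ) {j : ℕ} (hj : j + 2 ≤ s.card) :
    ((j : ℝ) + 2) * ((s.card : ℝ) - j) * (s.esymm (j + 2) * s.esymm j) ≤
      ((j : ℝ) + 1) * ((s.card : ℝ) - j - 1) * s.esymm (j + 1) ^ 2 := by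
  obtain ⟨t, ht⟩ := Nat.exists_eq_add_of_le hj
  set P : ℝ[X] := (s.map fun y => X + C y).prod with hP
  have hPs : P.Splits := Splits.multisetProd (by
    intro f hf
    obtain ⟨y, -, rfl⟩ := Multiset.mem_map.1 hf
    exact Splits.X_add_C y)
  have hdeg : (derivative^[t] P).natDegree = j + 2 := by
    have hPm : P.Monic := monic_multiset_prod_of_monic _ _ fun y _ => monic_X_add_C y
    have hPd : P.natDegree = j + 2 + t := by
      rw [hP, natDegree_multiset_prod_of_monic _ (by simp [monic_X_add_C])]
      simp [ht]
    refine le_antisymm ((natDegree_iterate_derivative P t).trans (by omega))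
      (le_natDegree_of_ne_zero ?_)
    rw [coeff_iterate_derivative, ← hPd, coeff_natDegree, hPm, nsmul_one]
    exact_mod_cast (Nat.descFactorial_pos.2 (by omega)).ne'
  have h := laguerre_of_splits (splits_iterate_derivative_of_splits hPs t) 0
  rw [hdeg] at h
  have hc : ∀ i ≤ 2, P.coeff (i + t) = s.esymm (j + 2 - i) := by
    intro i hi
    rw [hP, Multiset.prod_X_add_C_coeff s (by omega)]
    congr 1
    omega
  have hF (i : ℕ) : ((i + t).descFactorial t : ℝ) * (i.factorial : ℝ) = (i + t).factorial := by
    have := Nat.factorial_mul_descFactorial (show t ≤ i + t by omega)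
    rw [Nat.add_sub_cancel] at this
    rw [mul_comm]
    exact_mod_cast this
  simp only [← coeff_zero_eq_eval_zero, coeff_derivative, coeff_iterate_derivative, zero_add,
    Nat.reduceAdd, nsmul_eq_mul] at h
  have hc0 := hc 0 (by omega)
  rw [zero_add] at hc0
  rw [hc 1 (by omega), hc 2 le_rfl, hc0] at h
  have h0 := hF 0
  have h1 := hF 1
  have h2 := hF 2
  simp only [zero_add, Nat.factorial_zero, Nat.factorial_one, Nat.factorial_two, Nat.cast_one,
    mul_one, Nat.cast_ofNat] at h0 h1 h2
  rw [show 1 + t = t + 1 by omega, Nat.factorial_succ] at h1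
  rw [show 2 + t = t + 1 + 1 by omega, Nat.factorial_succ, Nat.factorial_succ] at h2
  push_cast at h1 h2 h
  rw [show 1 + t = t + 1 by omega, show 2 + t = t + 1 + 1 by omega] at h
  simp only [zero_add] at h
  rw [h0, h1] at h
  have hpos : (0 : ℝ) < t.factorial ^ 2 * (t + 1) := by positivity
  have hcard : (s.card : ℝ) = j + 2 + t := by rw [ht]; push_cast; ring
  rw [hcard]
  refine le_of_mul_le_mul_left ?_ hpos
  linear_combination h + (j + 2) * (t.factorial : ℝ) * s.esymm (j + 2) * s.esymm j * (-h2)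

/-- Pascal-type recursion for elementary symmetric functions. -/
theorem esymm_cons_succ (a : ℝ) (s : Multiset ℝ) (j : ℕ) :
    (a ::ₘ s).esymm (j + 1) = s.esymm (j + 1) + a * s.esymm j := by
  simp [Multiset.esymm, Multiset.powersetCard_cons, Multiset.map_map,
    Multiset.sum_map_mul_left]

/-- Consequence of Newton's inequalities when the elementary symmetric functions are positive. -/
theorem esymm_succ_le_esymm_one_mul (s : Multiset ℝ) {k : ℕ} (hk : k ≤ s.card)
    (hpos : ∀ j ≤ k, 0 < s.esymm j) {j : ℕ} (hj : j + 1 ≤ k) :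
    (s.card : ℝ) * (j + 1) * s.esymm (j + 1) ≤ ((s.card : ℝ) - j) * (s.esymm 1 * s.esymm j) := by
  induction j with
  | zero => simp [Multiset.esymm]
  | succ j ih =>
    have ih := ih (by omega)
    have hN := newton_esymm s (j := j) (by omega)
    have h0 := hpos j (by omega)
    have h1 := hpos (j + 1) (by omega)
    have hc : (j : ℝ) + 2 ≤ s.card := by exact_mod_cast (show j + 2 ≤ s.card by omega)
    have hp : 0 < ((s.card : ℝ) - j) * s.esymm j := mul_pos (by linarith) h0
    refine le_of_mul_le_mul_left ?_ hp
    push_cast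
    have e1 := mul_le_mul_of_nonneg_left hN (by linarith : (0 : ℝ) ≤ s.card)
    have e2 := mul_le_mul_of_nonneg_left ih
      (mul_nonneg (by linarith : (0 : ℝ) ≤ (s.card : ℝ) - j - 1) h1.le)
    rw [show j + 1 + 1 = j + 2 from rfl]
    linarith

/-- Lower bound for an entry of a tuple in the closed Gårding cone `Γ_k`. -/
theorem neg_mul_esymm_one_le (a : ℝ) (s : Multiset ℝ) {k : ℕ} (hk1 : 1 ≤ k) (hk : k ≤ s.card)
    (h : ∀ j, 1 ≤ j → j ≤ k → 0 ≤ (a ::ₘ s).esymm j) :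
    -(((s.card : ℝ) + 1 - k) * (a ::ₘ s).esymm 1) ≤ ((s.card : ℝ) + 1) * (k - 1) * a := by
  have hkc : (k : ℝ) ≤ s.card := by exact_mod_cast hk
  have hk1' : (1 : ℝ) ≤ k := by exact_mod_cast hk1
  rcases le_or_gt 0 a with ha | ha
  · have h1 := mul_nonneg (by linarith : (0 : ℝ) ≤ s.card + 1 - k) (h 1 le_rfl hk1)
    have h2 := mul_nonneg (mul_nonneg (by linarith : (0 : ℝ) ≤ s.card + 1)
      (by linarith : (0 : ℝ) ≤ (k : ℝ) - 1)) ha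
    linarith
  have hpos : ∀ j ≤ k, 0 < s.esymm j := by
    intro j
    induction j with
    | zero => simp [Multiset.esymm]
    | succ j ih =>
      intro hj
      have h1 := h (j + 1) (by omega) hj
      rw [esymm_cons_succ] at h1
      nlinarith [ih (by omega)]
  obtain ⟨j, rfl⟩ := Nat.exists_eq_add_of_le' hk1
  have hS := h (j + 1) (by omega) le_rfl
  have hM := esymm_succ_le_esymm_one_mul s hk hpos le_rfl
  have hj := hpos j (by omega)
  rw [esymm_cons_succ] at hS
  have h1 : (a ::ₘ s).esymm 1 = s.esymm 1 + a := by
    simp [Multiset.esymm, add_comm]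
  have key : (s.card : ℝ) * (j + 1) * (-a) ≤ ((s.card : ℝ) - j) * s.esymm 1 := by
    refine le_of_mul_le_mul_left ?_ hj
    have := mul_le_mul_of_nonneg_left hS (by positivity : (0 : ℝ) ≤ s.card * (j + 1))
    linarith
  rw [h1]
  push_cast
  linarith

/-- Each entry of a tuple in the closed Gårding cone `Γ_k`, `k < m`, is bounded below by
`-(m - k) / (m (k - 1))` times the sum of the entries. -/
theorem neg_mul_sum_le_of_esymmF_nonneg {m k : ℕ} (hk1 : 1 ≤ k) (hkm : k < m) (lam : Fin m → ℝ)
    (h : ∀ j, 1 ≤ j → j ≤ k → 0 ≤ esymmF j lam) (i : Fin m) :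
    -(((m : ℝ) - k) * ∑ l, lam l) ≤ (m : ℝ) * (k - 1) * lam i := by
  have hs : (Finset.univ : Finset (Fin m)).val.map lam =
      lam i ::ₘ ((Finset.univ.erase i).val.map lam) := by
    rw [← Multiset.map_cons, ← Finset.insert_val_of_notMem (Finset.notMem_erase i _),
      Finset.insert_erase (Finset.mem_univ i)]
  have he (j : ℕ) : esymmF j lam = (lam i ::ₘ ((Finset.univ.erase i).val.map lam)).esymm j := by
    rw [← hs, Finset.esymm_map_val]
    rfl
  have hcard : ((Finset.univ.erase i).val.map lam).card + 1 = m := by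
    rw [Multiset.card_map, Finset.card_val, Finset.card_erase_add_one (Finset.mem_univ i),
      Finset.card_univ, Fintype.card_fin]
  have hcard' : (((Finset.univ.erase i).val.map lam).card : ℝ) + 1 = m := by exact_mod_cast hcard
  have := neg_mul_esymm_one_le (lam i) ((Finset.univ.erase i).val.map lam) hk1 (by omega)
    (fun j h1 h2 => he j ▸ h j h1 h2)
  rw [hcard', ← he 1] at this
  simpa [esymmF, Finset.powersetCard_one] using this

open Matrix in
/-- The quadratic form of a real symmetric matrix is bounded below by any lower bound for its
eigenvalues. -/
theorem mul_dotProduct_le_of_le_eigenvalues {m : ℕ} {A : Matrix (Fin m) (Fin m) ℝ}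
    (hA : A.IsHermitian) {c : ℝ} (hc : ∀ i, c ≤ hA.eigenvalues i) (v : Fin m → ℝ) :
    c * (v ⬝ᵥ v) ≤ v ⬝ᵥ A *ᵥ v := by
  have hB : (A + algebraMap ℝ (Matrix (Fin m) (Fin m) ℝ) (-c)).IsHermitian := by
    refine hA.add ?_
    rw [Matrix.algebraMap_eq_diagonal]
    exact Matrix.isHermitian_diagonal _
  have hpsd := hB.posSemidef_iff_eigenvalues_nonneg.2 (by
    intro i
    have hi : hB.eigenvalues i ∈ spectrum ℝ (A + algebraMap ℝ _ (-c)) := by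
      rw [hB.spectrum_real_eq_range_eigenvalues]
      exact ⟨i, rfl⟩
    rw [← spectrum.add_singleton_eq, hA.spectrum_real_eq_range_eigenvalues] at hi
    obtain ⟨_, ⟨l, rfl⟩, _, rfl, hl⟩ := hi
    have := hc l
    simp only [Pi.zero_apply]
    simp only at hl
    linarith)
  have := hpsd.re_dotProduct_nonneg v
  simp only [star_trivial, Matrix.add_mulVec, Algebra.algebraMap_eq_smul_one, Matrix.smul_mulVec,
    Matrix.one_mulVec, dotProduct_add, dotProduct_smul, smul_eq_mul, RCLike.re_to_real] at this
  linarith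

/-- estimate (3.15). For a `k`-convex function, `2 ≤ k < m`, and
`0 ≤ r < m(k-1)/(m-k)`, `p = r + 2`, one has
`|Xu|^r Δ_X u ≤ [m(k-1)/(m(k-1) - r(m-k))] Δ_p u` wherever `Xu ≠ 0`. -/
theorem grad_pow_subLap_le (n m k : ℕ) (Ω : Set (Fin n → ℝ))
    (hΩo : IsOpen Ω) (hΩb : Bornology.IsBounded Ω)
    (b : Fin m → (Fin n → ℝ) → (Fin n → ℝ))
    (hb : ∀ i, ContDiffOn ℝ (⊤ : ℕ∞) (b i) (closure Ω))
    (hk2 : 2 ≤ k) (hkm : k < m)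
    (u : (Fin n → ℝ) → ℝ) (hu : ContDiffOn ℝ 2 u Ω) (hconv : IsKConvex Ω b k u)
    (r : ℝ) (hr0 : 0 ≤ r)
    (hr : r < ((m : ℝ) * ((k : ℝ) - 1)) / ((m : ℝ) - (k : ℝ)))
    (p : ℝ) (hp : p = r + 2) :
    ∀ x ∈ Ω, (∑ i, (Xop (b i) u x) ^ 2) ≠ 0 →
      XgradNorm b u x ^ r * subLap b u x ≤
        (((m : ℝ) * ((k : ℝ) - 1)) /
            ((m : ℝ) * ((k : ℝ) - 1) - r * ((m : ℝ) - (k : ℝ)))) *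
          (XgradNorm b u x ^ (p - 2) *
            (subLap b u x + (p - 2) * XgradNorm b u x ^ (-2 : ℝ) *
              ∑ i : Fin m, ∑ j : Fin m,
                Xop (b i) u x * Xop (b j) u x * Xop (b i) (Xop (b j) u) x)) := by
  intro x hx hne
  have hkm' : (k : ℝ) < m := by exact_mod_cast hkm
  have hk2' : (2 : ℝ) ≤ k := by exact_mod_cast hk2
  set T := subLap b u x with hT
  set Q := ∑ i : Fin m, ∑ j : Fin m,
    Xop (b i) u x * Xop (b j) u x * Xop (b i) (Xop (b j) u) x with hQ
  set N := ∑ i, Xop (b i) u x ^ 2 with hN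
  have hNpos : 0 < N := lt_of_le_of_ne (Finset.sum_nonneg fun i _ => sq_nonneg _) (Ne.symm hne)
  have hG : 0 < XgradNorm b u x := Real.sqrt_pos.2 hNpos
  have hG2 : XgradNorm b u x ^ (-2 : ℝ) = N⁻¹ := by
    rw [Real.rpow_neg hG.le, Real.rpow_two, XgradNorm, Real.sq_sqrt hNpos.le]
  have htr : ∑ i, hessEig b u x i = T := by
    have := (symmHess_isHermitian b u x).trace_eq_sum_eigenvalues
    simp only [RCLike.ofReal_real_eq_id, id] at this
    rw [hessEig, ← this, hT, subLap, Matrix.trace]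
    exact Finset.sum_congr rfl fun i _ => by simp [symmHess]
  have hquad : (fun i => Xop (b i) u x) ⬝ᵥ (symmHess b u x).mulVec (fun i => Xop (b i) u x) = Q := by
    have hsw : Q = ∑ i : Fin m, ∑ j : Fin m,
        Xop (b i) u x * Xop (b j) u x * Xop (b j) (Xop (b i) u) x := by
      rw [hQ, Finset.sum_comm]
      exact Finset.sum_congr rfl fun i _ => Finset.sum_congr rfl fun j _ => by ring
    have hhalf : Q = (Q + Q) / 2 := by ring
    rw [hhalf]
    nth_rewrite 2 [hsw]
    simp only [hQ, dotProduct, Matrix.mulVec, symmHess, Finset.mul_sum, ← Finset.sum_add_distrib,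
      Finset.sum_div]
    exact Finset.sum_congr rfl fun i _ => Finset.sum_congr rfl fun j _ => by ring
  have hM : 0 < (m : ℝ) * (k - 1) := by apply mul_pos <;> linarith
  have hlow := mul_dotProduct_le_of_le_eigenvalues (symmHess_isHermitian b u x)
    (c := -(((m : ℝ) - k) * T) / (m * (k - 1))) (fun i => by
      rw [div_le_iff₀' hM, ← htr]
      exact neg_mul_sum_le_of_esymmF_nonneg (by omega) hkm _ (hconv x hx) i)
    (fun i => Xop (b i) u x)
  rw [hquad, show (fun i => Xop (b i) u x) ⬝ᵥ (fun i => Xop (b i) u x) = N by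
    simp [dotProduct, hN, sq], div_mul_eq_mul_div, div_le_iff₀' hM] at hlow
  have hD : 0 < (m : ℝ) * (k - 1) - r * (m - k) := by
    rw [lt_div_iff₀ (by linarith)] at hr
    linarith
  rw [show p - 2 = r by linarith, hG2, mul_left_comm]
  refine mul_le_mul_of_nonneg_left ?_ (Real.rpow_nonneg hG.le r)
  rw [div_mul_eq_mul_div, le_div_iff₀ hD]
  have hfin : -(((m : ℝ) - k) * T) ≤ m * (k - 1) * (N⁻¹ * Q) := by
    rw [← mul_le_mul_iff_left₀ hNpos]
    calc _ ≤ _ := hlow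
      _ = _ := by field_simp
  linarith [mul_le_mul_of_nonneg_left hfin hr0]
end
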